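/- arXiv:1105.0611 — 13 statements merged into one kernel-verified Lean document; each statement's English description precedes it below -/
import Mathlib

section
/- Let P be an n×n Hermitian complex matrix satisfying the algebraic Riccati equation R(P) = P·M·P + Â·P + P·Â* + N = 0, and define B₁ := −(P·C* + B·D*)·(I_p − D·D*)^{−1/2}, where (I_p − D·D*)^{1/2} denotes the (unique) positive definite Hermitian square root. Then P satisfies the Lyapunov equation A·P + P·A* + B₁·B₁* + B·B* = 0. -/
open Matrix ComplexOrder

/-- The push-through form of the inverse of `1 - Y X` in terms of the inverse of `1 - X Y`. -/
theorem Matrix.inv_one_sub_mul_comm {m k R : Type*} [Fintype m] [DecidableEq m] [Fintype k]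
    [DecidableEq k] [CommRing R] (X : Matrix m k R) (Y : Matrix k m R)
    (h : IsUnit (1 - X * Y).det) :
    (1 - Y * X)⁻¹ = 1 + Y * (1 - X * Y)⁻¹ * X := by
  apply Matrix.inv_eq_right_inv
  calc (1 - Y * X) * (1 + Y * (1 - X * Y)⁻¹ * X)
      = 1 - Y * X + Y * ((1 - X * Y) * (1 - X * Y)⁻¹) * X := by
        simp only [Matrix.sub_mul, Matrix.mul_sub, Matrix.mul_add, Matrix.one_mul,
          Matrix.mul_one, Matrix.mul_assoc]
    _ = 1 := by rw [Matrix.mul_nonsing_inv _ h, Matrix.mul_one, sub_add_cancel]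

/-- If `P` is a Hermitian solution of the Riccati equation
`P M P + Â P + P Âᴴ + N = 0` and `B₁ = -(P Cᴴ + B Dᴴ) (I - D Dᴴ)^{-1/2}`, then
`A P + P Aᴴ + B₁ B₁ᴴ + B Bᴴ = 0`. -/
theorem lyapunov_from_riccati {n p : ℕ} (hn : 0 < n) (hp : 0 < p)
    (A : Matrix (Fin n) (Fin n) ℂ) (B : Matrix (Fin n) (Fin p) ℂ)
    (C : Matrix (Fin p) (Fin n) ℂ) (D : Matrix (Fin p) (Fin p) ℂ)
    (hD1 : (1 - D * Dᴴ).PosDef) (hD2 : (1 - Dᴴ * D).PosDef)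
    (Ahat M N : Matrix (Fin n) (Fin n) ℂ)
    (hAhat : Ahat = A + B * Dᴴ * (1 - D * Dᴴ)⁻¹ * C)
    (hM : M = Cᴴ * (1 - D * Dᴴ)⁻¹ * C)
    (hN : N = B * (1 - Dᴴ * D)⁻¹ * Bᴴ)
    (P : Matrix (Fin n) (Fin n) ℂ) (hP : Pᴴ = P)
    (hRicc : P * M * P + Ahat * P + P * Ahatᴴ + N = 0)
    -- `D21` is the unique positive definite Hermitian square root of `I - D Dᴴ`
    (D21 : Matrix (Fin p) (Fin p) ℂ) (hD21 : D21.PosDef)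
    (hD21sq : D21 * D21 = 1 - D * Dᴴ)
    (B₁ : Matrix (Fin n) (Fin p) ℂ)
    (hB₁ : B₁ = -((P * Cᴴ + B * Dᴴ) * D21⁻¹)) :
    A * P + P * Aᴴ + B₁ * B₁ᴴ + B * Bᴴ = 0 := by
  have hS : ((1 - D * Dᴴ)⁻¹)ᴴ = (1 - D * Dᴴ)⁻¹ := hD1.isHermitian.inv
  have hT : (1 - Dᴴ * D)⁻¹ = 1 + Dᴴ * (1 - D * Dᴴ)⁻¹ * D :=
    Matrix.inv_one_sub_mul_comm D Dᴴ ((Matrix.isUnit_iff_isUnit_det _).mp hD1.isUnit)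
  have hinv : D21⁻¹ * (D21⁻¹)ᴴ = (1 - D * Dᴴ)⁻¹ := by
    rw [hD21.isHermitian.inv.eq, ← Matrix.mul_inv_rev, hD21sq]
  have hBB : B₁ * B₁ᴴ = (P * Cᴴ + B * Dᴴ) * (1 - D * Dᴴ)⁻¹ * (C * P + D * Bᴴ) := by
    rw [hB₁, ← hinv]
    simp only [conjTranspose_neg, conjTranspose_mul, conjTranspose_add,
      conjTranspose_conjTranspose, hP, Matrix.neg_mul, Matrix.mul_neg, neg_neg, Matrix.mul_assoc]
  rw [hBB, ← hRicc, hM, hN, hAhat, hT]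
  simp only [conjTranspose_mul, conjTranspose_add, conjTranspose_conjTranspose, hS,
    Matrix.add_mul, Matrix.mul_add, Matrix.mul_one, Matrix.mul_assoc]
  abel
end

section
/- Let P be an n×n Hermitian complex matrix with R(P) = 0 and set Z := Â + P·M. Then the similarity relation [[I_n, 0],[−P, I_n]] · H · [[I_n, 0],[P, I_n]] = [[−Z*, −M],[0, Z]] holds, and consequently the characteristic polynomial of H factors as χ_H(s) = χ_Z(s)·χ_{−Z*}(s), where χ_K denotes the characteristic polynomial of a square matrix K. -/
open Matrix ComplexOrder

/-- If `P` is a Hermitian solution of the Riccati equation and `Z = Â + P M`, then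
`[[I,0],[-P,I]] H [[I,0],[P,I]] = [[-Zᴴ,-M],[0,Z]]`, hence
`χ_H = χ_Z · χ_{-Zᴴ}`. -/
theorem similarity_and_charpoly_split {n p : ℕ} (hn : 0 < n) (hp : 0 < p)
    (A : Matrix (Fin n) (Fin n) ℂ) (B : Matrix (Fin n) (Fin p) ℂ)
    (C : Matrix (Fin p) (Fin n) ℂ) (D : Matrix (Fin p) (Fin p) ℂ)
    (hD1 : (1 - D * Dᴴ).PosDef) (hD2 : (1 - Dᴴ * D).PosDef)
    (Ahat M N : Matrix (Fin n) (Fin n) ℂ)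
    (hAhat : Ahat = A + B * Dᴴ * (1 - D * Dᴴ)⁻¹ * C)
    (hM : M = Cᴴ * (1 - D * Dᴴ)⁻¹ * C)
    (hN : N = B * (1 - Dᴴ * D)⁻¹ * Bᴴ)
    (H : Matrix (Fin n ⊕ Fin n) (Fin n ⊕ Fin n) ℂ)
    (hH : H = fromBlocks (-Ahatᴴ) (-M) N Ahat)
    (P : Matrix (Fin n) (Fin n) ℂ) (hP : Pᴴ = P)
    (hRicc : P * M * P + Ahat * P + P * Ahatᴴ + N = 0)
    (Z : Matrix (Fin n) (Fin n) ℂ) (hZ : Z = Ahat + P * M) :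
    fromBlocks 1 0 (-P) 1 * H * fromBlocks 1 0 P 1 = fromBlocks (-Zᴴ) (-M) 0 Z ∧
    H.charpoly = Z.charpoly * (-Zᴴ).charpoly := by
  have hMH : Mᴴ = M := by
    rw [hM, conjTranspose_mul, conjTranspose_mul, conjTranspose_conjTranspose,
      hD1.isHermitian.inv.eq, Matrix.mul_assoc]
  have hsim : fromBlocks 1 0 (-P) 1 * H * fromBlocks 1 0 P 1 = fromBlocks (-Zᴴ) (-M) 0 Z := by
    rw [hH, hZ, fromBlocks_multiply, fromBlocks_multiply, conjTranspose_add, conjTranspose_mul,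
      hMH, hP, fromBlocks_inj]
    refine ⟨?_, ?_, ?_, ?_⟩
    · noncomm_ring
    · noncomm_ring
    · rw [← hRicc]
      noncomm_ring
    · noncomm_ring
  have hinv : fromBlocks 1 0 P 1 * fromBlocks 1 0 (-P) 1 =
      (1 : Matrix (Fin n ⊕ Fin n) (Fin n ⊕ Fin n) ℂ) := by
    simp [fromBlocks_multiply]
  refine ⟨hsim, ?_⟩
  calc H.charpoly = (fromBlocks 1 0 (-P) 1 * H * fromBlocks 1 0 P 1).charpoly := by
        rw [charpoly_mul_comm, ← Matrix.mul_assoc, hinv, Matrix.one_mul]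
    _ = Z.charpoly * (-Zᴴ).charpoly := by
        rw [hsim, charpoly_fromBlocks_zero₂₁, mul_comm]
end

section
/- Let P and P̃ be n×n Hermitian complex matrices with R(P) = 0 and R(P̃) = 0, set Z := Â + P·M and Γ := P̃ − P. Then Γ satisfies the homogeneous algebraic Riccati equation Z·Γ + Γ·Z* + Γ·M·Γ = 0. -/
open Matrix ComplexOrder

/-- If `P` and `P̃` are Hermitian solutions of the Riccati equation, `Z = Â + P M`
and `Γ = P̃ - P`, then `Z Γ + Γ Zᴴ + Γ M Γ = 0`. -/
theorem gamma_homogeneous_riccati {n p : ℕ} (hn : 0 < n) (hp : 0 < p)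
    (A : Matrix (Fin n) (Fin n) ℂ) (B : Matrix (Fin n) (Fin p) ℂ)
    (C : Matrix (Fin p) (Fin n) ℂ) (D : Matrix (Fin p) (Fin p) ℂ)
    (hD1 : (1 - D * Dᴴ).PosDef) (hD2 : (1 - Dᴴ * D).PosDef)
    (Ahat M N : Matrix (Fin n) (Fin n) ℂ)
    (hAhat : Ahat = A + B * Dᴴ * (1 - D * Dᴴ)⁻¹ * C)
    (hM : M = Cᴴ * (1 - D * Dᴴ)⁻¹ * C)
    (hN : N = B * (1 - Dᴴ * D)⁻¹ * Bᴴ)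
    (P Pt : Matrix (Fin n) (Fin n) ℂ) (hP : Pᴴ = P) (hPt : Ptᴴ = Pt)
    (hRicc : P * M * P + Ahat * P + P * Ahatᴴ + N = 0)
    (hRicct : Pt * M * Pt + Ahat * Pt + Pt * Ahatᴴ + N = 0)
    (Z : Matrix (Fin n) (Fin n) ℂ) (hZ : Z = Ahat + P * M)
    (Γ : Matrix (Fin n) (Fin n) ℂ) (hΓ : Γ = Pt - P) :
    Z * Γ + Γ * Zᴴ + Γ * M * Γ = 0 := by
  have hMH : Mᴴ = M := by
    rw [hM]
    exact isHermitian_conjTranspose_mul_mul C hD1.isHermitian.inv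
  have hZH : Zᴴ = Ahatᴴ + M * P := by
    rw [hZ, conjTranspose_add, conjTranspose_mul, hMH, hP]
  calc Z * Γ + Γ * Zᴴ + Γ * M * Γ
      = (Pt * M * Pt + Ahat * Pt + Pt * Ahatᴴ + N)
        - (P * M * P + Ahat * P + P * Ahatᴴ + N) := by
        rw [hZH, hZ, hΓ]
        noncomm_ring
    _ = 0 := by rw [hRicc, hRicct, sub_zero]
end

section
/- Assume the realization is symmetric: A = Aᵀ, B = Cᵀ, D = Dᵀ. Then Â = Âᵀ and N = Mᵀ, and moreover for every invertible Hermitian n×n complex matrix P with R(P) = 0, the matrix P^{−T} := (P⁻¹)ᵀ is Hermitian and satisfies R(P^{−T}) = 0. -/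
open Matrix ComplexOrder

/-- The push-through identity `Dᴴ (1 - D Dᴴ)⁻¹ = (1 - Dᴴ D)⁻¹ Dᴴ`. -/
theorem conjTranspose_mul_inv_one_sub {p : ℕ} {D : Matrix (Fin p) (Fin p) ℂ}
    (hD1 : IsUnit (1 - D * Dᴴ).det) (hD2 : IsUnit (1 - Dᴴ * D).det) :
    Dᴴ * (1 - D * Dᴴ)⁻¹ = (1 - Dᴴ * D)⁻¹ * Dᴴ := by
  have h : (1 - Dᴴ * D) * Dᴴ = Dᴴ * (1 - D * Dᴴ) := by noncomm_ring
  calc Dᴴ * (1 - D * Dᴴ)⁻¹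
      = (1 - Dᴴ * D)⁻¹ * ((1 - Dᴴ * D) * Dᴴ) * (1 - D * Dᴴ)⁻¹ := by
        rw [nonsing_inv_mul_cancel_left _ _ hD2]
    _ = (1 - Dᴴ * D)⁻¹ * Dᴴ := by
        rw [h, ← Matrix.mul_assoc, mul_nonsing_inv_cancel_right _ _ hD1]

/-- Multiplying a Riccati equation by the inverse of the solution on both sides. -/
theorem riccati_inv {n : ℕ} {P F G M N : Matrix (Fin n) (Fin n) ℂ} (hP : IsUnit P.det)
    (h : P * M * P + F * P + P * G + N = 0) :
    M + P⁻¹ * F + G * P⁻¹ + P⁻¹ * N * P⁻¹ = 0 := by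
  have h' : P⁻¹ * (P * M * P + F * P + P * G + N) * P⁻¹ = 0 := by
    rw [h, Matrix.mul_zero, Matrix.zero_mul]
  simpa only [Matrix.mul_add, Matrix.add_mul, Matrix.mul_assoc, mul_nonsing_inv _ hP,
    nonsing_inv_mul_cancel_left _ _ hP, Matrix.mul_one] using h'

/-- For a symmetric realization (`A = Aᵀ`, `B = Cᵀ`, `D = Dᵀ`) one has `Â = Âᵀ`
and `N = Mᵀ`, and if `P` is an invertible Hermitian solution of the Riccati
equation then so is `(P⁻¹)ᵀ`. -/
theorem symmetric_realization_riccati {n p : ℕ} (hn : 0 < n) (hp : 0 < p)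
    (A : Matrix (Fin n) (Fin n) ℂ) (B : Matrix (Fin n) (Fin p) ℂ)
    (C : Matrix (Fin p) (Fin n) ℂ) (D : Matrix (Fin p) (Fin p) ℂ)
    (hD1 : (1 - D * Dᴴ).PosDef) (hD2 : (1 - Dᴴ * D).PosDef)
    (hAsym : A = Aᵀ) (hBsym : B = Cᵀ) (hDsym : D = Dᵀ)
    (Ahat M N : Matrix (Fin n) (Fin n) ℂ)
    (hAhat : Ahat = A + B * Dᴴ * (1 - D * Dᴴ)⁻¹ * C)
    (hM : M = Cᴴ * (1 - D * Dᴴ)⁻¹ * C)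
    (hN : N = B * (1 - Dᴴ * D)⁻¹ * Bᴴ) :
    Ahat = Ahatᵀ ∧ N = Mᵀ ∧
    ∀ P : Matrix (Fin n) (Fin n) ℂ, IsUnit P → Pᴴ = P →
      P * M * P + Ahat * P + P * Ahatᴴ + N = 0 →
      (((P⁻¹)ᵀ)ᴴ = (P⁻¹)ᵀ ∧
        (P⁻¹)ᵀ * M * (P⁻¹)ᵀ + Ahat * (P⁻¹)ᵀ + (P⁻¹)ᵀ * Ahatᴴ + N = 0) := by
  have hU1 : IsUnit (1 - D * Dᴴ).det := (isUnit_iff_isUnit_det _).mp hD1.isUnit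
  have hU2 : IsUnit (1 - Dᴴ * D).det := (isUnit_iff_isUnit_det _).mp hD2.isUnit
  have hDH : Dᴴᵀ = Dᴴ := by rw [← conjTranspose_transpose_eq_transpose_conjTranspose, ← hDsym]
  have hCH : Cᴴᵀ = Bᴴ := by rw [hBsym, conjTranspose_transpose_eq_transpose_conjTranspose]
  have hBT : Bᵀ = C := by rw [hBsym, transpose_transpose]
  have hinv : ((1 - D * Dᴴ)⁻¹)ᵀ = (1 - Dᴴ * D)⁻¹ := by
    rw [transpose_nonsing_inv, transpose_sub, transpose_mul, transpose_one, hDH, ← hDsym]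
  have hA : Ahat = Ahatᵀ := by
    rw [hAhat, transpose_add, transpose_mul, transpose_mul, transpose_mul, hinv, hDH, hBT,
      ← hAsym, ← hBsym, Matrix.mul_assoc B, conjTranspose_mul_inv_one_sub hU1 hU2]
    simp only [Matrix.mul_assoc]
  have hNM : N = Mᵀ := by
    rw [hN, hM, transpose_mul, transpose_mul, hinv, hCH, ← hBsym, Matrix.mul_assoc]
  refine ⟨hA, hNM, fun P hP hPH hR => ⟨?_, ?_⟩⟩
  · rw [conjTranspose_transpose_eq_transpose_conjTranspose, conjTranspose_nonsing_inv, hPH]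
  · have hAH : Ahatᴴᵀ = Ahatᴴ := by rw [← conjTranspose_transpose_eq_transpose_conjTranspose, ← hA]
    have hNT : Nᵀ = M := by rw [hNM, transpose_transpose]
    have h := congrArg transpose (riccati_inv ((isUnit_iff_isUnit_det _).mp hP) hR)
    simp only [transpose_add, transpose_mul, transpose_zero, hNT, ← hNM, ← hA, hAH] at h
    rw [← h, Matrix.mul_assoc]
    abel
end

section
/- Assume the realization is symmetric: A = Aᵀ, B = Cᵀ, D = Dᵀ. Suppose every Hermitian n×n complex matrix P with R(P) = 0 is positive definite, and suppose P̌ is a Hermitian matrix with R(P̌) = 0 that is minimal: for every Hermitian P with R(P) = 0, the matrix P − P̌ is positive semidefinite. Then P̂ := (P̌⁻¹)ᵀ is Hermitian, satisfies R(P̂) = 0, and is maximal: for every Hermitian P with R(P) = 0, the matrix P̂ − P is positive semidefinite. -/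
open Matrix ComplexOrder

namespace Matrix

/-- Inversion is antitone for the Loewner order on positive definite matrices. -/
theorem PosDef.posSemidef_inv_sub_inv {m : Type*} [Fintype m] [DecidableEq m]
    {X Y : Matrix m m ℂ} (hX : X.PosDef) (hY : Y.PosDef) (h : (Y - X).PosSemidef) :
    (X⁻¹ - Y⁻¹).PosSemidef := by
  have hXd : IsUnit X.det := (isUnit_iff_isUnit_det X).mp hX.isUnit
  have hYd : IsUnit Y.det := (isUnit_iff_isUnit_det Y).mp hY.isUnit
  have hYi : (Y⁻¹)ᴴ = Y⁻¹ := hY.inv.isHermitian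
  have first := h.conjTranspose_mul_mul_same Y⁻¹
  have second := hX.inv.posSemidef.conjTranspose_mul_mul_same ((Y - X) * Y⁻¹)
  rw [conjTranspose_mul, h.isHermitian.eq, hYi] at second
  rw [hYi] at first
  convert first.add second using 1
  have hl : Y⁻¹ * (Y - X) = 1 - Y⁻¹ * X := by rw [mul_sub, nonsing_inv_mul _ hYd]
  have hr : (Y - X) * Y⁻¹ = 1 - X * Y⁻¹ := by rw [sub_mul, mul_nonsing_inv _ hYd]
  have hm : (1 - Y⁻¹ * X) * X⁻¹ = X⁻¹ - Y⁻¹ := by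
    rw [sub_mul, one_mul, mul_assoc, mul_nonsing_inv _ hXd, mul_one]
  have hn : X⁻¹ * (X * Y⁻¹) = Y⁻¹ := nonsing_inv_mul_cancel_left _ _ hXd
  rw [hl, hr, hm, sub_mul X⁻¹, mul_sub X⁻¹, mul_one, hn]
  noncomm_ring

/-- If the constant and quadratic coefficients of a Riccati equation are transposes of each other
and the linear coefficient is symmetric, then inverse transposition preserves its invertible
solutions. -/
theorem riccati_inv_transpose {m : Type*} [Fintype m] [DecidableEq m]
    {F M N P : Matrix m m ℂ} (hF : Fᵀ = F) (hM : Mᵀ = N) (hN : Nᵀ = M)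
    (hP : IsUnit P.det) (h : P * M * P + F * P + P * Fᴴ + N = 0) :
    (P⁻¹)ᵀ * M * (P⁻¹)ᵀ + F * (P⁻¹)ᵀ + (P⁻¹)ᵀ * Fᴴ + N = 0 := by
  have hFt : (Fᴴ)ᵀ = Fᴴ := congrArg conjTranspose hF
  have key : P⁻¹ * N * P⁻¹ + P⁻¹ * F + Fᴴ * P⁻¹ + M = 0 := by
    have h' : P⁻¹ * (P * M * P + F * P + P * Fᴴ + N) * P⁻¹ = 0 := by
      rw [h, mul_zero, zero_mul]
    rw [← h']
    simp only [mul_add, add_mul, mul_assoc, mul_nonsing_inv _ hP, mul_one,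
      nonsing_inv_mul_cancel_left _ _ hP]
    abel
  have := congrArg transpose key
  simp only [transpose_add, transpose_mul, hF, hFt, hM, hN, transpose_zero] at this
  rw [← this]
  simp only [mul_assoc]

/-- The push-through identity. -/
theorem inv_one_sub_mul_mul_eq {k l : Type*} [Fintype k] [DecidableEq k] [Fintype l]
    [DecidableEq l] {E : Matrix k l ℂ} {D : Matrix l k ℂ}
    (h₁ : IsUnit (1 - D * E).det) (h₂ : IsUnit (1 - E * D).det) :
    (1 - E * D)⁻¹ * E = E * (1 - D * E)⁻¹ := by
  have h : E * (1 - D * E) = (1 - E * D) * E := by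
    rw [Matrix.mul_sub, Matrix.sub_mul, Matrix.mul_one, Matrix.one_mul, Matrix.mul_assoc]
  calc (1 - E * D)⁻¹ * E = (1 - E * D)⁻¹ * (E * (1 - D * E)) * (1 - D * E)⁻¹ := by
        rw [Matrix.mul_assoc, mul_nonsing_inv_cancel_right _ _ h₁]
    _ = E * (1 - D * E)⁻¹ := by
        rw [h, nonsing_inv_mul_cancel_left _ _ h₂]

end Matrix

/-- For a symmetric realization, if every Hermitian solution of the Riccati
equation is positive definite and `P̌` is the minimal Hermitian solution, then
`P̂ = (P̌⁻¹)ᵀ` is the maximal Hermitian solution. -/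
theorem minimal_inverse_transpose_is_maximal {n p : ℕ} (hn : 0 < n) (hp : 0 < p)
    (A : Matrix (Fin n) (Fin n) ℂ) (B : Matrix (Fin n) (Fin p) ℂ)
    (C : Matrix (Fin p) (Fin n) ℂ) (D : Matrix (Fin p) (Fin p) ℂ)
    (hD1 : (1 - D * Dᴴ).PosDef) (hD2 : (1 - Dᴴ * D).PosDef)
    (hAsym : A = Aᵀ) (hBsym : B = Cᵀ) (hDsym : D = Dᵀ)
    (Ahat M N : Matrix (Fin n) (Fin n) ℂ)
    (hAhat : Ahat = A + B * Dᴴ * (1 - D * Dᴴ)⁻¹ * C)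
    (hM : M = Cᴴ * (1 - D * Dᴴ)⁻¹ * C)
    (hN : N = B * (1 - Dᴴ * D)⁻¹ * Bᴴ)
    (hpos : ∀ P : Matrix (Fin n) (Fin n) ℂ, Pᴴ = P →
      P * M * P + Ahat * P + P * Ahatᴴ + N = 0 → P.PosDef)
    (Pc : Matrix (Fin n) (Fin n) ℂ) (hPc : Pcᴴ = Pc)
    (hPcRicc : Pc * M * Pc + Ahat * Pc + Pc * Ahatᴴ + N = 0)
    (hPcmin : ∀ P : Matrix (Fin n) (Fin n) ℂ, Pᴴ = P →
      P * M * P + Ahat * P + P * Ahatᴴ + N = 0 → (P - Pc).PosSemidef) :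
    ((Pc⁻¹)ᵀ)ᴴ = (Pc⁻¹)ᵀ ∧
    (Pc⁻¹)ᵀ * M * (Pc⁻¹)ᵀ + Ahat * (Pc⁻¹)ᵀ + (Pc⁻¹)ᵀ * Ahatᴴ + N = 0 ∧
    ∀ P : Matrix (Fin n) (Fin n) ℂ, Pᴴ = P →
      P * M * P + Ahat * P + P * Ahatᴴ + N = 0 → ((Pc⁻¹)ᵀ - P).PosSemidef := by
  have hd₁ : IsUnit (1 - D * Dᴴ).det := (isUnit_iff_isUnit_det _).mp hD1.isUnit
  have hd₂ : IsUnit (1 - Dᴴ * D).det := (isUnit_iff_isUnit_det _).mp hD2.isUnit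
  have hBt : Bᵀ = C := by rw [hBsym, transpose_transpose]
  have hCt : Cᵀ = B := hBsym.symm
  have hDt : (Dᴴ)ᵀ = Dᴴ := congrArg conjTranspose hDsym.symm
  have hBh : (Bᴴ)ᵀ = Cᴴ := congrArg conjTranspose hBt
  have hinv : ((1 - D * Dᴴ)⁻¹)ᵀ = (1 - Dᴴ * D)⁻¹ := by
    rw [transpose_nonsing_inv, transpose_sub, transpose_one, transpose_mul, hDt, ← hDsym]
  have hMN : Mᵀ = N := by
    rw [hM, hN, transpose_mul, transpose_mul, hinv, hCt, ← hBh, transpose_transpose,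
      Matrix.mul_assoc]
  have hNM : Nᵀ = M := by rw [← hMN, transpose_transpose]
  have hF : Ahatᵀ = Ahat := by
    rw [hAhat, transpose_add, ← hAsym]
    simp only [transpose_mul, hinv, hCt, hBt, hDt]
    rw [← Matrix.mul_assoc (1 - Dᴴ * D)⁻¹, inv_one_sub_mul_mul_eq hd₁ hd₂]
    simp only [Matrix.mul_assoc]
  have hsol {P : Matrix (Fin n) (Fin n) ℂ} (hP : Pᴴ = P)
      (h : P * M * P + Ahat * P + P * Ahatᴴ + N = 0) :=
    riccati_inv_transpose hF hMN hNM
      ((isUnit_iff_isUnit_det _).mp (hpos P hP h).isUnit) h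
  have hherm {P : Matrix (Fin n) (Fin n) ℂ} (hP : Pᴴ = P) : ((P⁻¹)ᵀ)ᴴ = (P⁻¹)ᵀ :=
    (IsHermitian.inv hP).transpose
  refine ⟨hherm hPc, hsol hPc hPcRicc, fun P hP h => ?_⟩
  have hPd : IsUnit P.det := (isUnit_iff_isUnit_det _).mp (hpos P hP h).isUnit
  have hle := (hpos Pc hPc hPcRicc).posSemidef_inv_sub_inv
    (hpos _ (hherm hP) (hsol hP h)) (hPcmin _ (hherm hP) (hsol hP h))
  rw [← transpose_nonsing_inv, nonsing_inv_nonsing_inv _ hPd] at hle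
  simpa using hle.transpose
end

section
/- Let ξ be a complex number with Re ξ > 0, let u ∈ ℂᵖ be a unit vector, and let T be a function from ℂ to p×p complex matrices that is analytic at ξ, such that T(s) is symmetric (T(s)ᵀ = T(s)) for all s in a neighborhood of ξ, T(ξ)·u = 0, and uᵀ·T′(ξ)·u = 0, where T′(ξ) is the derivative of T at ξ. Then the function s ↦ B_{ξ,u}(s)^{−T}·T(s)·B_{ξ,u}(s)^{−1} extends analytically to ξ: there exists a function G analytic at ξ such that G(s) = (I_p + (b_ξ(s)⁻¹ − 1)·ū·uᵀ)·T(s)·(I_p + (b_ξ(s)⁻¹ − 1)·u·u*) for all s ≠ ξ in some punctured neighborhood of ξ. -/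
open Matrix ComplexConjugate

theorem AnalyticAt.analyticAt_dslope {f : ℂ → ℂ} {z : ℂ} (hf : AnalyticAt ℂ f z) :
    AnalyticAt ℂ (dslope f z) z :=
  let ⟨_, h⟩ := hf
  ⟨_, h.has_fpower_series_dslope_fslope⟩

theorem eq_sub_mul_dslope_of_zero {f : ℂ → ℂ} {z : ℂ} (hf : f z = 0) (s : ℂ) :
    f s = (s - z) * dslope f z s := by
  simpa [hf] using (sub_smul_dslope f z s).symm

theorem one_add_vecMulVec_mul_mul_apply {n : Type*} [Fintype n] [DecidableEq n]
    (A : Matrix n n ℂ) (c : ℂ) (u v : n → ℂ) (i j : n) :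
    ((1 + c • vecMulVec v u) * A * (1 + c • vecMulVec u v)) i j =
      A i j + c * v i * (Aᵀ *ᵥ u) j + c * (A *ᵥ u) i * v j +
        c ^ 2 * (u ⬝ᵥ A *ᵥ u) * v i * v j := by
  have h : vecMulVec v u * A * vecMulVec u v = (u ⬝ᵥ A *ᵥ u) • vecMulVec v v := by
    rw [vecMulVec_mul, vecMulVec_mul_vecMulVec, dotProduct_mulVec]
    simp [vecMulVec_smul]
  simp only [add_mul, mul_add, one_mul, mul_one, Matrix.smul_mul, Matrix.mul_smul, h]
  simp only [vecMulVec_mul, mul_vecMulVec, mulVec_transpose, Matrix.add_apply,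
    Matrix.smul_apply, vecMulVec_apply, smul_eq_mul]
  ring

/-- If `T` is analytic at `ξ`, symmetric near `ξ`, with `T(ξ)u = 0` and
`uᵀ T'(ξ) u = 0`, then `s ↦ B_{ξ,u}(s)^{-T} T(s) B_{ξ,u}(s)⁻¹` extends
analytically to `ξ`. -/
theorem blaschke_division_analytic {p : ℕ} (hp : 0 < p)
    (ξ : ℂ) (hξ : 0 < ξ.re)
    (u : Fin p → ℂ) (hu : star u ⬝ᵥ u = 1)
    (T : ℂ → Matrix (Fin p) (Fin p) ℂ)
    (hT : ∀ i j, AnalyticAt ℂ (fun s => T s i j) ξ)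
    (hsymm : ∀ᶠ s in nhds ξ, (T s)ᵀ = T s)
    (hTu : (T ξ).mulVec u = 0)
    (hT'u : u ⬝ᵥ (Matrix.of fun i j => deriv (fun s => T s i j) ξ).mulVec u = 0)
    (b : ℂ → ℂ) (hb : ∀ s : ℂ, b s = (s - ξ) / (s + conj ξ)) :
    ∃ G : ℂ → Matrix (Fin p) (Fin p) ℂ,
      (∀ i j, AnalyticAt ℂ (fun s => G s i j) ξ) ∧
      ∀ᶠ s in nhdsWithin ξ {ξ}ᶜ,
        G s = (1 + ((b s)⁻¹ - 1) • vecMulVec (star u) u) * T s *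
              (1 + ((b s)⁻¹ - 1) • vecMulVec u (star u)) := by
  have hv : ∀ i, AnalyticAt ℂ (fun s => (T s *ᵥ u) i) ξ := fun i => by
    simp only [mulVec, dotProduct]
    exact Finset.analyticAt_fun_sum _ fun j _ => (hT i j).mul analyticAt_const
  have hq : AnalyticAt ℂ (fun s => u ⬝ᵥ T s *ᵥ u) ξ := by
    simp only [dotProduct]
    exact Finset.analyticAt_fun_sum _ fun i _ => analyticAt_const.mul (hv i)
  have hq' : deriv (fun s => u ⬝ᵥ T s *ᵥ u) ξ = 0 := by
    rw [← hT'u]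
    refine HasDerivAt.deriv ?_
    simp only [mulVec, dotProduct, of_apply]
    exact HasDerivAt.fun_sum fun i _ => HasDerivAt.const_mul _ <|
      HasDerivAt.fun_sum fun j _ => (hT i j).differentiableAt.hasDerivAt.mul_const _
  set q : ℂ → ℂ := fun s => u ⬝ᵥ T s *ᵥ u with hq_def
  let w : Fin p → ℂ → ℂ := fun i => dslope (fun s => (T s *ᵥ u) i) ξ
  let r : ℂ → ℂ := dslope (dslope q ξ) ξ
  have hw : ∀ i, AnalyticAt ℂ (w i) ξ := fun i => (hv i).analyticAt_dslope
  have hr : AnalyticAt ℂ r ξ := hq.analyticAt_dslope.analyticAt_dslope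
  have hvw : ∀ s i, (T s *ᵥ u) i = (s - ξ) * w i s := fun s i =>
    eq_sub_mul_dslope_of_zero (f := fun s => (T s *ᵥ u) i) (by simp [hTu]) s
  have hqr : ∀ s, u ⬝ᵥ T s *ᵥ u = (s - ξ) ^ 2 * r s := fun s => by
    rw [pow_two, mul_assoc, ← eq_sub_mul_dslope_of_zero (by rw [dslope_same, hq']) s]
    exact eq_sub_mul_dslope_of_zero (f := q) (by simp [hq_def, hTu]) s
  refine ⟨fun s => of fun i j => T s i j + (ξ + conj ξ) * star u i * w j s +
    (ξ + conj ξ) * w i s * star u j + (ξ + conj ξ) ^ 2 * r s * star u i * star u j,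
    fun i j => ?_, ?_⟩
  · have h₁ := hT i j
    have h₂ := hw i
    have h₃ := hw j
    simp only [of_apply]
    fun_prop
  · filter_upwards [nhdsWithin_le_nhds hsymm, self_mem_nhdsWithin] with s hs hne
    have hne : s - ξ ≠ 0 := sub_ne_zero.mpr hne
    have hc : (b s)⁻¹ - 1 = (ξ + conj ξ) / (s - ξ) := by
      rw [hb, inv_div]
      field_simp
      ring
    ext i j
    rw [one_add_vecMulVec_mul_mul_apply, hs, hvw, hvw, hqr, hc, of_apply]
    field_simp
end

section
/- Assume the realization is symmetric: A = Aᵀ, B = Cᵀ, D = Dᵀ. Let P be an n×n Hermitian complex matrix with R(P) = 0 and P·Pᵀ = I_n, and set Z := Â + P·M. Then the characteristic polynomial of H is a perfect square: χ_H = (χ_Z)², where χ_K denotes the characteristic polynomial of a square matrix K. -/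
open Matrix ComplexOrder

namespace Matrix

/-- The push-through identity for resolvents of products. -/
theorem mul_one_sub_mul_inv {R m k : Type*} [CommRing R] [Fintype m] [DecidableEq m]
    [Fintype k] [DecidableEq k] (X : Matrix m k R) (Y : Matrix k m R)
    (hXY : IsUnit (1 - X * Y)) (hYX : IsUnit (1 - Y * X)) :
    (1 - Y * X)⁻¹ * Y = Y * (1 - X * Y)⁻¹ := by
  have hXY' := (isUnit_iff_isUnit_det _).mp hXY
  have hYX' := (isUnit_iff_isUnit_det _).mp hYX
  have h : (1 - Y * X) * Y = Y * (1 - X * Y) := by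
    simp only [Matrix.sub_mul, Matrix.mul_sub, Matrix.one_mul, Matrix.mul_one, Matrix.mul_assoc]
  calc (1 - Y * X)⁻¹ * Y
      = (1 - Y * X)⁻¹ * (Y * (1 - X * Y)) * (1 - X * Y)⁻¹ := by
        rw [← Matrix.mul_assoc, mul_nonsing_inv_cancel_right _ _ hXY']
    _ = Y * (1 - X * Y)⁻¹ := by rw [← h, nonsing_inv_mul_cancel_left _ _ hYX']

theorem charpoly_mul_mul_of_mul_eq_one {R m : Type*} [CommRing R] [Fintype m] [DecidableEq m]
    {S T : Matrix m m R} (h : S * T = 1) (W : Matrix m m R) :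
    (S * W * T).charpoly = W.charpoly := by
  rw [charpoly_mul_comm, ← Matrix.mul_assoc, mul_eq_one_comm.mp h, Matrix.one_mul]

/-- A Riccati solution block-triangularizes the associated Hamiltonian-type matrix. -/
theorem charpoly_fromBlocks_of_riccati {R m : Type*} [CommRing R] [Fintype m] [DecidableEq m]
    (E F M N P : Matrix m m R) (h : P * M * P + E * P + P * F + N = 0) :
    (fromBlocks (-F) (-M) N E).charpoly = (-(F + M * P)).charpoly * (E + P * M).charpoly := by
  have hinv : fromBlocks 1 0 (-P) 1 * fromBlocks 1 0 P 1 = (1 : Matrix (m ⊕ m) (m ⊕ m) R) := by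
    simp [fromBlocks_multiply, ← fromBlocks_one]
  rw [← charpoly_fromBlocks_zero₂₁ _ (-M), ← charpoly_mul_mul_of_mul_eq_one hinv]
  congr 1
  simp only [fromBlocks_multiply, Matrix.one_mul, Matrix.mul_one, Matrix.zero_mul,
    Matrix.mul_zero, add_zero, zero_add]
  congr 1
  · noncomm_ring
  · rw [← h]
    noncomm_ring
  · noncomm_ring

end Matrix

/-- For a symmetric realization, if `P` is a Hermitian solution of the Riccati
equation with `P Pᵀ = I` and `Z = Â + P M`, then `χ_H = (χ_Z)²`. -/
theorem charpoly_perfect_square {n p : ℕ} (hn : 0 < n) (hp : 0 < p)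
    (A : Matrix (Fin n) (Fin n) ℂ) (B : Matrix (Fin n) (Fin p) ℂ)
    (C : Matrix (Fin p) (Fin n) ℂ) (D : Matrix (Fin p) (Fin p) ℂ)
    (hD1 : (1 - D * Dᴴ).PosDef) (hD2 : (1 - Dᴴ * D).PosDef)
    (hAsym : A = Aᵀ) (hBsym : B = Cᵀ) (hDsym : D = Dᵀ)
    (Ahat M N : Matrix (Fin n) (Fin n) ℂ)
    (hAhat : Ahat = A + B * Dᴴ * (1 - D * Dᴴ)⁻¹ * C)
    (hM : M = Cᴴ * (1 - D * Dᴴ)⁻¹ * C)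
    (hN : N = B * (1 - Dᴴ * D)⁻¹ * Bᴴ)
    (H : Matrix (Fin n ⊕ Fin n) (Fin n ⊕ Fin n) ℂ)
    (hH : H = fromBlocks (-Ahatᴴ) (-M) N Ahat)
    (P : Matrix (Fin n) (Fin n) ℂ) (hP : Pᴴ = P)
    (hRicc : P * M * P + Ahat * P + P * Ahatᴴ + N = 0)
    (hPPt : P * Pᵀ = 1)
    (Z : Matrix (Fin n) (Fin n) ℂ) (hZ : Z = Ahat + P * M) :
    H.charpoly = Z.charpoly ^ 2 := by
  have hDc : Dᴴᵀ = Dᴴ := by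
    change Dᵀᴴ = Dᴴ
    rw [← hDsym]
  have hinvT : ((1 - D * Dᴴ)⁻¹)ᵀ = (1 - Dᴴ * D)⁻¹ := by
    rw [transpose_nonsing_inv, transpose_sub, transpose_one, transpose_mul, hDc, ← hDsym]
  have hCt : Cᴴᵀ = Bᴴ := by
    rw [hBsym]
    rfl
  have hMT : Mᵀ = N := by
    rw [hM, hN, transpose_mul, transpose_mul, hinvT, hCt, ← hBsym, Matrix.mul_assoc]
  have hBT : Bᵀ = C := by rw [hBsym, transpose_transpose]
  have hAhatT : Ahatᵀ = Ahat := by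
    rw [hAhat, transpose_add, ← hAsym, transpose_mul, transpose_mul, transpose_mul, hinvT, hDc,
      ← hBsym, hBT, ← Matrix.mul_assoc (1 - Dᴴ * D)⁻¹,
      mul_one_sub_mul_inv D Dᴴ hD1.isUnit hD2.isUnit]
    simp only [Matrix.mul_assoc]
  have hconj : P * -(Ahatᴴ + M * P) * Pᵀ = Zᵀ := by
    have h : P * -(Ahatᴴ + M * P) = Ahat * P + N := by
      rw [← sub_eq_zero, ← neg_eq_zero, ← hRicc]
      noncomm_ring
    rw [h, Matrix.add_mul, Matrix.mul_assoc, hPPt, Matrix.mul_one, hZ, transpose_add,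
      transpose_mul, hMT, hAhatT]
  rw [hH, charpoly_fromBlocks_of_riccati _ _ _ _ _ hRicc, ← hZ,
    ← charpoly_mul_mul_of_mul_eq_one hPPt, hconj, charpoly_transpose, sq]
end

section
/- Assume the realization is symmetric: A = Aᵀ, B = Cᵀ, D = Dᵀ. Let P be an n×n Hermitian positive definite complex matrix with R(P) = 0, and let κ be the number of distinct complex numbers z with Re z > 0 that are roots of odd multiplicity of the characteristic polynomial of H. Then the rank of the matrix (P⁻¹)ᵀ − P is at least κ. -/
open Matrix ComplexOrder

open Polynomial in
theorem LinearMap.charpoly_eq_charpoly_restrict_mul_charpoly_mapQ {K V : Type*} [Field K]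
    [Infinite K] [AddCommGroup V] [Module K V] [FiniteDimensional K V] (W : Submodule K V)
    (f : V →ₗ[K] V) (hf : W ≤ W.comap f) :
    f.charpoly = (f.restrict hf).charpoly * (W.mapQ W f hf).charpoly := by
  refine Polynomial.funext fun t => ?_
  have ht : W ≤ W.comap (algebraMap K (Module.End K V) t - f) := fun x hx =>
    W.sub_mem (W.smul_mem t hx) (hf hx)
  rw [eval_mul, LinearMap.eval_charpoly, LinearMap.eval_charpoly, LinearMap.eval_charpoly,
    LinearMap.det_eq_det_mul_det W _ ht]
  congr 2
  ext x
  rfl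

/-- Two matrices that agree on an invariant subspace `ker X` have characteristic polynomials which
agree up to factors of degree `X.rank`. -/
theorem Matrix.exists_charpoly_eq_mul_of_rank {n K : Type*} [Fintype n] [DecidableEq n] [Field K]
    [Infinite K] {X E F G Y : Matrix n n K} (hXE : X * E = Y * X) (hF : F = E + G * X) :
    ∃ q a b : Polynomial K, E.charpoly = q * a ∧ F.charpoly = q * b ∧
      a.natDegree = X.rank ∧ b.natDegree = X.rank := by
  set W := LinearMap.ker X.mulVecLin with hW
  have hE : W ≤ W.comap (toLin' E) := fun x hx => by
    simp only [hW, LinearMap.mem_ker, mulVecLin_apply, Submodule.mem_comap, toLin'_apply] at hx ⊢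
    rw [mulVec_mulVec, hXE, ← mulVec_mulVec, hx, mulVec_zero]
  have hEF : ∀ x ∈ W, toLin' F x = toLin' E x := fun x hx => by
    simp only [hW, LinearMap.mem_ker, mulVecLin_apply, toLin'_apply] at hx ⊢
    rw [hF, add_mulVec, ← mulVec_mulVec, hx, mulVec_zero, add_zero]
  have hF' : W ≤ W.comap (toLin' F) := fun x hx => by
    rw [Submodule.mem_comap, hEF x hx]
    exact hE hx
  have hres : LinearMap.restrict (toLin' F) (p := W) (q := W) hF' =
      LinearMap.restrict (toLin' E) (p := W) (q := W) hE := by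
    ext1 x
    exact Subtype.ext (hEF x x.2)
  have hdim : Module.finrank K ((n → K) ⧸ W) = X.rank :=
    X.mulVecLin.quotKerEquivRange.finrank_eq
  refine ⟨(LinearMap.restrict (toLin' E) (p := W) (q := W) hE).charpoly,
    (W.mapQ W _ hE).charpoly, (W.mapQ W _ hF').charpoly,
    ?_, ?_, ?_, ?_⟩
  · rw [← LinearMap.charpoly_eq_charpoly_restrict_mul_charpoly_mapQ, Matrix.charpoly_toLin']
  · rw [← hres, ← LinearMap.charpoly_eq_charpoly_restrict_mul_charpoly_mapQ,
      Matrix.charpoly_toLin']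
  · rw [LinearMap.charpoly_natDegree, hdim]
  · rw [LinearMap.charpoly_natDegree, hdim]

theorem Polynomial.card_le_of_rootMultiplicity_ne {K : Type*} [Field K] {q a b : Polynomial K}
    (ha : q * a ≠ 0) (hb : q * b ≠ 0) (T : Finset K)
    (hT : ∀ z ∈ T, (q * a).rootMultiplicity z ≠ (q * b).rootMultiplicity z) :
    T.card ≤ a.natDegree + b.natDegree := by
  have hab : a * b ≠ 0 := mul_ne_zero (right_ne_zero_of_mul ha) (right_ne_zero_of_mul hb)
  rw [← natDegree_mul (right_ne_zero_of_mul ha) (right_ne_zero_of_mul hb)]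
  refine Polynomial.card_le_degree_of_subset_roots fun z hz => ?_
  rw [mem_roots hab, ← rootMultiplicity_pos hab, rootMultiplicity_mul hab]
  have := hT z hz
  rw [rootMultiplicity_mul ha, rootMultiplicity_mul hb] at this
  omega

theorem Matrix.charpoly_neg_eq_comp {n R : Type*} [Fintype n] [DecidableEq n] [CommRing R]
    (E : Matrix n n R) :
    (-E).charpoly = (-1) ^ Fintype.card n * E.charpoly.comp (-Polynomial.X) := by
  have h : (-E).charmatrix =
      -(Polynomial.compRingHom (-Polynomial.X)).mapMatrix E.charmatrix := by
    ext1 i j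
    by_cases hij : i = j
    · subst hij
      simp [charmatrix_apply_eq, add_comm]
    · simp [charmatrix_apply_ne _ _ _ hij]
  rw [charpoly, h, det_neg, ← RingHom.map_det, Polynomial.coe_compRingHom_apply, charpoly]

theorem Matrix.rootMultiplicity_charpoly_neg {n K : Type*} [Fintype n] [DecidableEq n] [Field K]
    (E : Matrix n n K) (z : K) :
    (-E).charpoly.rootMultiplicity (-z) = E.charpoly.rootMultiplicity z := by
  classical
  have h : ((-1) ^ Fintype.card n : Polynomial K) =
      Polynomial.C ((-1) ^ Fintype.card n) := by simp
  rw [charpoly_neg_eq_comp, h, ← Polynomial.count_roots, Polynomial.roots_C_mul _ (by simp),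
    Polynomial.roots_comp_neg_X, Multiset.count_map_eq_count' _ _ neg_injective,
    Polynomial.count_roots]

theorem Matrix.rootMultiplicity_charpoly_neg_conjTranspose {n : Type*} [Fintype n] [DecidableEq n]
    (E : Matrix n n ℂ) (z : ℂ) :
    (-Eᴴ).charpoly.rootMultiplicity (-star z) = E.charpoly.rootMultiplicity z := by
  have h : Eᴴ.charpoly = E.charpoly.map (starRingEnd ℂ) := by
    rw [← charpoly_map, ← charpoly_transpose (E.map _)]
    rfl
  rw [rootMultiplicity_charpoly_neg, h]
  exact (Polynomial.eq_rootMultiplicity_map (starRingEnd ℂ).injective z).symm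

theorem Matrix.charpoly_hamiltonian {n R : Type*} [Fintype n] [DecidableEq n] [CommRing R]
    {A₁ A₂ M N P : Matrix n n R} (h : P * M * P + A₂ * P + P * A₁ + N = 0) :
    (fromBlocks (-A₁) (-M) N A₂).charpoly = (-(A₁ + M * P)).charpoly * (A₂ + P * M).charpoly := by
  have hconj : fromBlocks 1 0 (-P) 1 * fromBlocks (-A₁) (-M) N A₂ * fromBlocks 1 0 P 1 =
      fromBlocks (-(A₁ + M * P)) (-M) 0 (A₂ + P * M) := by
    rw [fromBlocks_multiply, fromBlocks_multiply, fromBlocks_inj]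
    refine ⟨?_, ?_, ?_, ?_⟩
    · simp [add_comm]
    · simp
    · rw [← h]
      noncomm_ring
    · simp [add_comm]
  have hinv : fromBlocks 1 0 P 1 * fromBlocks 1 0 (-P) 1 = (1 : Matrix (n ⊕ n) (n ⊕ n) R) := by
    simp [fromBlocks_multiply]
  rw [← charpoly_fromBlocks_zero₂₁ (M₁₂ := -M), ← hconj, charpoly_mul_comm, ← Matrix.mul_assoc,
    hinv, Matrix.one_mul]

theorem Matrix.inv_one_sub_mul_mul {m n R : Type*} [Fintype m] [DecidableEq m] [Fintype n]
    [DecidableEq n] [CommRing R] {S : Matrix m n R} {T : Matrix n m R}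
    (h₁ : IsUnit (1 - S * T)) (h₂ : IsUnit (1 - T * S)) :
    (1 - T * S)⁻¹ * T = T * (1 - S * T)⁻¹ := by
  rw [isUnit_iff_isUnit_det] at h₁ h₂
  have h : T * (1 - S * T) = (1 - T * S) * T := by
    simp only [Matrix.mul_sub, Matrix.sub_mul, Matrix.mul_assoc, Matrix.mul_one, Matrix.one_mul]
  calc (1 - T * S)⁻¹ * T = (1 - T * S)⁻¹ * (T * (1 - S * T)) * (1 - S * T)⁻¹ := by
        rw [Matrix.mul_assoc, Matrix.mul_assoc, mul_nonsing_inv _ h₁, Matrix.mul_one]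
    _ = T * (1 - S * T)⁻¹ := by
        rw [h, ← Matrix.mul_assoc, nonsing_inv_mul _ h₂, Matrix.one_mul]

/-- The involution `P ↦ (P⁻¹)ᵀ` preserves the solutions of a symmetric Riccati equation. -/
theorem Matrix.riccati_inv_transpose_s13 {n R : Type*} [Fintype n] [DecidableEq n] [CommRing R]
    {A₁ A₂ M N P : Matrix n n R} (hP : IsUnit P.det) (hA₁ : A₁ᵀ = A₁) (hA₂ : A₂ᵀ = A₂)
    (hM : Mᵀ = N) (h : P * M * P + A₂ * P + P * A₁ + N = 0) :
    P⁻¹ᵀ * M * P⁻¹ᵀ + A₂ * P⁻¹ᵀ + P⁻¹ᵀ * A₁ + N = 0 := by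
  have hN : N = -(P * M * P + A₂ * P + P * A₁) := by
    rw [eq_neg_iff_add_eq_zero, add_comm, h]
  have key : P⁻¹ * N * P⁻¹ + P⁻¹ * A₂ + A₁ * P⁻¹ + M = 0 := by
    have e : P⁻¹ * N * P⁻¹ = -((P⁻¹ * P) * M * (P * P⁻¹) + P⁻¹ * A₂ * (P * P⁻¹)
        + (P⁻¹ * P) * A₁ * P⁻¹) := by
      rw [hN]; noncomm_ring
    rw [e, nonsing_inv_mul _ hP, mul_nonsing_inv _ hP]
    simp only [Matrix.mul_one, Matrix.one_mul]
    abel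
  have := congrArg transpose key
  simp only [transpose_add, transpose_mul, hA₁, hA₂, ← hM, transpose_transpose,
    transpose_zero] at this
  rw [← this, ← hM]
  noncomm_ring

/-- Each pair `z`, `-star z` of points where the multiplicities of two
polynomials differ contributes two to the total degree of their non-common factors. -/
theorem Polynomial.ncard_le_of_odd_rootMultiplicity {q a b : Polynomial ℂ} (ha : q * a ≠ 0)
    (hb : q * b ≠ 0) {r : ℕ} (har : a.natDegree = r) (hbr : b.natDegree = r)
    (hsymm : ∀ z, (q * b).rootMultiplicity (-star z) = (q * a).rootMultiplicity z) :
    {z : ℂ | 0 < z.re ∧ Odd (((q * a) * (q * b)).rootMultiplicity z)}.ncard ≤ r := by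
  classical
  have hab : (q * a) * (q * b) ≠ 0 := mul_ne_zero ha hb
  set S := {z : ℂ | 0 < z.re ∧ Odd (((q * a) * (q * b)).rootMultiplicity z)} with hS
  have hfin : S.Finite := by
    refine (((q * a) * (q * b)).roots.toFinset.finite_toSet).subset fun z hz => ?_
    simp only [Finset.mem_coe, Multiset.mem_toFinset, mem_roots hab]
    exact (rootMultiplicity_pos hab).1 hz.2.pos
  have hinj : Function.Injective fun z : ℂ => -star z := neg_injective.comp star_injective
  set T := hfin.toFinset
  have hne : ∀ z ∈ T, (q * a).rootMultiplicity z ≠ (q * b).rootMultiplicity z := fun z hz h => by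
    have hz := ((hfin.mem_toFinset).1 hz).2
    rw [rootMultiplicity_mul hab, h] at hz
    exact Nat.not_odd_iff_even.2 ⟨_, rfl⟩ hz
  have hdisj : Disjoint T (T.image fun z => -star z) := by
    rw [Finset.disjoint_left]
    intro z hz hz'
    obtain ⟨w, hw, rfl⟩ := Finset.mem_image.1 hz'
    have h₁ := ((hfin.mem_toFinset).1 hz).1
    have h₂ := ((hfin.mem_toFinset).1 hw).1
    simp at h₁
    linarith
  have hcard := card_le_of_rootMultiplicity_ne ha hb (T ∪ T.image fun z => -star z) <| by
    intro z hz
    rcases Finset.mem_union.1 hz with hz | hz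
    · exact hne z hz
    · obtain ⟨w, hw, rfl⟩ := Finset.mem_image.1 hz
      have h := hsymm (-star w)
      simp only [star_neg, star_star, neg_neg] at h
      rw [hsymm, ← h]
      exact (hne w hw).symm
  rw [Finset.card_union_of_disjoint hdisj, Finset.card_image_of_injective _ hinj, har, hbr] at hcard
  rw [Set.ncard_eq_toFinset_card S hfin]
  change T.card ≤ r
  omega

/-- For a symmetric realization, if `P` is a Hermitian positive definite
solution of the Riccati equation, then the rank of `(P⁻¹)ᵀ - P` is at least the
number `κ` of distinct points in the open right half-plane that are roots of odd
multiplicity of the characteristic polynomial of `H`. -/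
theorem rank_lower_bound_kappa {n p : ℕ} (hn : 0 < n) (hp : 0 < p)
    (A : Matrix (Fin n) (Fin n) ℂ) (B : Matrix (Fin n) (Fin p) ℂ)
    (C : Matrix (Fin p) (Fin n) ℂ) (D : Matrix (Fin p) (Fin p) ℂ)
    (hD1 : (1 - D * Dᴴ).PosDef) (hD2 : (1 - Dᴴ * D).PosDef)
    (hAsym : A = Aᵀ) (hBsym : B = Cᵀ) (hDsym : D = Dᵀ)
    (Ahat M N : Matrix (Fin n) (Fin n) ℂ)
    (hAhat : Ahat = A + B * Dᴴ * (1 - D * Dᴴ)⁻¹ * C)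
    (hM : M = Cᴴ * (1 - D * Dᴴ)⁻¹ * C)
    (hN : N = B * (1 - Dᴴ * D)⁻¹ * Bᴴ)
    (H : Matrix (Fin n ⊕ Fin n) (Fin n ⊕ Fin n) ℂ)
    (hH : H = fromBlocks (-Ahatᴴ) (-M) N Ahat)
    (P : Matrix (Fin n) (Fin n) ℂ) (hP : P.PosDef)
    (hRicc : P * M * P + Ahat * P + P * Ahatᴴ + N = 0)
    (κ : ℕ)
    (hκ : κ = {z : ℂ | 0 < z.re ∧ Odd (H.charpoly.rootMultiplicity z)}.ncard) :
    κ ≤ ((P⁻¹)ᵀ - P).rank := by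
  have hPu : IsUnit P.det := (isUnit_iff_isUnit_det P).1 hP.isUnit
  have hDH : Dᴴᵀ = Dᴴ := congrArg conjTranspose hDsym.symm
  have hBT : Bᵀ = C := by rw [hBsym, transpose_transpose]
  have hinvT : ((1 - D * Dᴴ)⁻¹)ᵀ = (1 - Dᴴ * D)⁻¹ := by
    rw [transpose_nonsing_inv, transpose_sub, transpose_one, transpose_mul, hDH, ← hDsym]
  have hAT : Ahatᵀ = Ahat := by
    rw [hAhat, transpose_add, ← hAsym, transpose_mul, transpose_mul, transpose_mul, hinvT, hDH,
      hBT, ← hBsym, ← Matrix.mul_assoc _ Dᴴ,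
      inv_one_sub_mul_mul hD1.isUnit hD2.isUnit]
    simp only [Matrix.mul_assoc]
  have hAHT : Ahatᴴᵀ = Ahatᴴ := congrArg conjTranspose hAT
  have hMT : Mᵀ = N := by
    rw [hM, hN, transpose_mul, transpose_mul, hinvT, ← hBsym, Matrix.mul_assoc, hBsym]
    rfl
  have hQ := riccati_inv_transpose_s13 hPu hAHT hAT hMT hRicc
  set Q := P⁻¹ᵀ with hQdef
  have hQu : IsUnit Q.det := by
    rw [hQdef, det_transpose]
    exact isUnit_nonsing_inv_det P hPu
  have hPQ : Pᵀ * Q = 1 := by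
    rw [hQdef, ← transpose_mul, nonsing_inv_mul _ hPu, transpose_one]
  have hPH : Pᴴ = P := hP.isHermitian
  have hMH : Mᴴ = M := by
    rw [hM, conjTranspose_mul, conjTranspose_mul, hD1.isHermitian.inv.eq, conjTranspose_conjTranspose,
      Matrix.mul_assoc]
  set E := -(Ahatᴴ + M * P) with hE
  set F := -(Ahatᴴ + M * Q) with hF
  have hEH : -Eᴴ = Ahat + P * M := by
    rw [hE, conjTranspose_neg, neg_neg, conjTranspose_add, conjTranspose_mul, hPH, hMH,
      conjTranspose_conjTranspose]
  have hEF : (Ahat + P * M).charpoly = F.charpoly := by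
    have h : (Ahat + P * M)ᵀ * Q = Q * F := by
      rw [transpose_add, transpose_mul, hAT, hMT, Matrix.add_mul, Matrix.mul_assoc, hPQ,
        Matrix.mul_one, hF, ← sub_eq_zero, ← hQ]
      noncomm_ring
    have h' : (Ahat + P * M)ᵀ = Q * F * Q⁻¹ := by
      rw [← h, Matrix.mul_assoc, mul_nonsing_inv _ hQu, Matrix.mul_one]
    rw [← charpoly_transpose, h', charpoly_mul_comm, ← Matrix.mul_assoc, nonsing_inv_mul _ hQu,
      Matrix.one_mul]
  have hHchar : H.charpoly = E.charpoly * F.charpoly := by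
    rw [hH, charpoly_hamiltonian hRicc, hEF]
  obtain ⟨q, a, b, hqa, hqb, ha, hb⟩ := exists_charpoly_eq_mul_of_rank
    (X := Q - P) (E := E) (F := F) (G := -M) (Y := Ahat + Q * M)
    (by
      rw [← sub_eq_zero, ← neg_eq_zero, ← sub_eq_zero.2 (hQ.trans hRicc.symm), hE]
      noncomm_ring)
    (by rw [hE, hF]; noncomm_ring)
  rw [hκ, hHchar, hqa, hqb]
  refine Polynomial.ncard_le_of_odd_rootMultiplicity ?_ ?_ ha hb fun z => ?_
  · exact hqa ▸ E.charpoly_monic.ne_zero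
  · exact hqb ▸ F.charpoly_monic.ne_zero
  · rw [← hqa, ← hqb, ← hEF, ← hEH, rootMultiplicity_charpoly_neg_conjTranspose]
end

section
/- Let A be an n×n real matrix and C a p×n real matrix such that the pair (C, A) is observable, i.e. the only x ∈ ℝⁿ with C·Aᵏ·x = 0 for all natural numbers k is x = 0. If P₂ is an n×n real matrix satisfying C·P₂ = 0 and A·P₂ + P₂·Aᵀ = 0, then P₂ = 0. -/
open Matrix

/-- If `(C, A)` is observable and `P₂` is a real matrix with `C P₂ = 0` and
`A P₂ + P₂ Aᵀ = 0`, then `P₂ = 0`. -/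
theorem observable_lyapunov_zero {n p : ℕ} (hn : 0 < n) (hp : 0 < p)
    (A : Matrix (Fin n) (Fin n) ℝ) (C : Matrix (Fin p) (Fin n) ℝ)
    (hobs : ∀ x : Fin n → ℝ, (∀ k : ℕ, C.mulVec ((A ^ k).mulVec x) = 0) → x = 0)
    (P₂ : Matrix (Fin n) (Fin n) ℝ)
    (hCP : C * P₂ = 0) (hLyap : A * P₂ + P₂ * Aᵀ = 0) :
    P₂ = 0 := by
  have hcomm : SemiconjBy P₂ (-Aᵀ) A := by
    rw [SemiconjBy, mul_neg]
    exact (eq_neg_of_add_eq_zero_left hLyap).symm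
  have hzero (k : ℕ) : C * (A ^ k * P₂) = 0 := by
    rw [← (hcomm.pow_right k).eq, ← Matrix.mul_assoc, hCP, Matrix.zero_mul]
  refine ext_of_mulVec_single fun j => ?_
  rw [zero_mulVec]
  refine hobs _ fun k => ?_
  rw [mulVec_mulVec, mulVec_mulVec, Matrix.mul_assoc, hzero, zero_mulVec]
end

section
/- Let A, B, C, D be real matrices of sizes n×n, n×p, p×n, p×p with I_p − D·Dᵀ and I_p − Dᵀ·D positive definite, and assume the pair (C, A) is observable: the only x ∈ ℂⁿ with C·Aᵏ·x = 0 for all natural numbers k is x = 0. Let P be an n×n complex Hermitian matrix with R(P) = 0. Then P has real entries if and only if for every real number s that is not an eigenvalue of A, the p×p matrix C·(sI_n − A)⁻¹·P·Cᵀ has real entries. -/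
open Matrix

section Resolvent

attribute [local instance] Matrix.linftyOpNormedRing Matrix.linftyOpNormedAlgebra

open Filter Topology in
/-- The resolvent of a complex matrix vanishes at infinity along the real axis. -/
lemma tendsto_resolvent_atTop {n : ℕ} (A : Matrix (Fin n) (Fin n) ℂ) :
    Tendsto (fun s : ℝ => ((s : ℂ) • (1 : Matrix (Fin n) (Fin n) ℂ) - A)⁻¹) atTop (𝓝 0) := by
  have hs : Tendsto (fun s : ℝ => (s : ℂ)) atTop (Bornology.cobounded ℂ) :=
    RCLike.tendsto_ofReal_atTop_cobounded ℂ
  refine ((spectrum.resolvent_tendsto_cobounded (𝕜 := ℂ) A).comp hs).congr fun s => ?_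
  simp [resolvent, Matrix.nonsing_inv_eq_ringInverse, Algebra.algebraMap_eq_smul_one]

open Filter in
/-- All large real numbers lie outside the spectrum of a complex matrix. -/
lemma eventually_det_smul_one_sub_ne_zero {n : ℕ} (A : Matrix (Fin n) (Fin n) ℂ) :
    ∀ᶠ s : ℝ in atTop, ((s : ℂ) • (1 : Matrix (Fin n) (Fin n) ℂ) - A).det ≠ 0 := by
  have hs : Tendsto (fun s : ℝ => (s : ℂ)) atTop (Bornology.cobounded ℂ) :=
    RCLike.tendsto_ofReal_atTop_cobounded ℂ
  filter_upwards [hs.eventually (spectrum.eventually_isUnit_resolvent (𝕜 := ℂ) A)] with s h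
  have h' := spectrum.isUnit_resolvent.mpr h
  rw [spectrum.mem_resolventSet_iff, Algebra.algebraMap_eq_smul_one,
    Matrix.isUnit_iff_isUnit_det] at h'
  exact h'.ne_zero

end Resolvent

open Filter Topology in
/-- If a matrix-valued transfer function vanishes for all real `s` off the spectrum,
then all its Markov parameters vanish. -/
lemma mul_pow_mul_eq_zero_of_resolvent {n p q : ℕ} (A : Matrix (Fin n) (Fin n) ℂ)
    (C : Matrix (Fin p) (Fin n) ℂ) (Y : Matrix (Fin n) (Fin q) ℂ)
    (h : ∀ s : ℝ, ((s : ℂ) • (1 : Matrix (Fin n) (Fin n) ℂ) - A).det ≠ 0 →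
      C * ((s : ℂ) • (1 : Matrix (Fin n) (Fin n) ℂ) - A)⁻¹ * Y = 0) (k : ℕ) :
    C * A ^ k * Y = 0 := by
  have step : ∀ Z : Matrix (Fin n) (Fin q) ℂ,
      (∀ s : ℝ, ((s : ℂ) • (1 : Matrix (Fin n) (Fin n) ℂ) - A).det ≠ 0 →
        C * ((s : ℂ) • (1 : Matrix (Fin n) (Fin n) ℂ) - A)⁻¹ * Z = 0) →
      C * Z = 0 ∧ ∀ s : ℝ, ((s : ℂ) • (1 : Matrix (Fin n) (Fin n) ℂ) - A).det ≠ 0 →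
        C * ((s : ℂ) • (1 : Matrix (Fin n) (Fin n) ℂ) - A)⁻¹ * (A * Z) = 0 := by
    intro Z hZ
    have key : ∀ s : ℝ, ((s : ℂ) • (1 : Matrix (Fin n) (Fin n) ℂ) - A).det ≠ 0 →
        C * ((s : ℂ) • (1 : Matrix (Fin n) (Fin n) ℂ) - A)⁻¹ * (A * Z) = -(C * Z) := by
      intro s hs
      have hR := Matrix.nonsing_inv_mul _ (isUnit_iff_ne_zero.mpr hs)
      have hZs := hZ s hs
      set R := ((s : ℂ) • (1 : Matrix (Fin n) (Fin n) ℂ) - A)⁻¹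
      have hRA : R * A = (s : ℂ) • R - 1 := by
        rw [← hR, Matrix.mul_sub, Matrix.mul_smul, Matrix.mul_one]; abel
      calc C * R * (A * Z) = C * (R * A) * Z := by simp only [Matrix.mul_assoc]
        _ = (s : ℂ) • (C * R * Z) - C * Z := by
          rw [hRA, Matrix.mul_sub, Matrix.sub_mul, Matrix.mul_smul, Matrix.smul_mul,
            Matrix.mul_one]
        _ = -(C * Z) := by rw [hZs, smul_zero, zero_sub]
    have hcont : Continuous fun T : Matrix (Fin n) (Fin n) ℂ => C * T * (A * Z) := by
      fun_prop
    have hlim : Tendsto (fun s : ℝ =>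
        C * ((s : ℂ) • (1 : Matrix (Fin n) (Fin n) ℂ) - A)⁻¹ * (A * Z)) atTop (𝓝 0) := by
      simpa [Function.comp_def] using (hcont.tendsto 0).comp (tendsto_resolvent_atTop A)
    have hconst : -(C * Z) = 0 := tendsto_nhds_unique
      (tendsto_const_nhds.congr' <| (eventually_det_smul_one_sub_ne_zero A).mono
        fun s hs => (key s hs).symm) hlim
    exact ⟨neg_eq_zero.mp hconst, fun s hs => (key s hs).trans hconst⟩
  have hall : ∀ j : ℕ, ∀ s : ℝ, ((s : ℂ) • (1 : Matrix (Fin n) (Fin n) ℂ) - A).det ≠ 0 →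
      C * ((s : ℂ) • (1 : Matrix (Fin n) (Fin n) ℂ) - A)⁻¹ * (A ^ j * Y) = 0 := by
    intro j
    induction j with
    | zero => simpa using h
    | succ j ih => simpa only [pow_succ', Matrix.mul_assoc] using (step _ ih).2
  rw [Matrix.mul_assoc]
  exact (step _ (hall k)).1

/-- Observability upgrades from vectors to matrices. -/
lemma eq_zero_of_observable {n p q : ℕ} {A : Matrix (Fin n) (Fin n) ℂ}
    {C : Matrix (Fin p) (Fin n) ℂ}
    (hobs : ∀ x : Fin n → ℂ, (∀ k : ℕ, C.mulVec ((A ^ k).mulVec x) = 0) → x = 0)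
    {Y : Matrix (Fin n) (Fin q) ℂ} (hY : ∀ k : ℕ, C * A ^ k * Y = 0) : Y = 0 := by
  refine Matrix.ext_of_mulVec_single fun j => ?_
  rw [Matrix.zero_mulVec]
  refine hobs _ fun k => ?_
  rw [Matrix.mulVec_mulVec, Matrix.mulVec_mulVec, hY, Matrix.zero_mulVec]

/-- A complex matrix is real iff its conjugate transpose is its transpose. -/
lemma im_eq_zero_iff_conjTranspose_eq_transpose {m n : Type*} (W : Matrix m n ℂ) :
    (∀ i j, (W i j).im = 0) ↔ Wᴴ = Wᵀ := by
  simp only [← Matrix.ext_iff, Matrix.conjTranspose_apply, Matrix.transpose_apply,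
    ← starRingEnd_apply, Complex.conj_eq_iff_im]
  exact forall_comm

lemma conjTranspose_map_ofReal {m n : Type*} (W : Matrix m n ℝ) :
    (W.map Complex.ofReal)ᴴ = (W.map Complex.ofReal)ᵀ := by
  rw [← im_eq_zero_iff_conjTranspose_eq_transpose]
  simp

/-- For a real realization with `(C, A)` observable, a Hermitian solution `P`
of the Riccati equation is real if and only if `C (sI - A)⁻¹ P Cᵀ` is real for
every real `s` that is not an eigenvalue of `A`. -/
theorem real_riccati_solution_iff {n p : ℕ} (hn : 0 < n) (hp : 0 < p)
    (A : Matrix (Fin n) (Fin n) ℝ) (B : Matrix (Fin n) (Fin p) ℝ)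
    (C : Matrix (Fin p) (Fin n) ℝ) (D : Matrix (Fin p) (Fin p) ℝ)
    (hD1 : (1 - D * Dᵀ).PosDef) (hD2 : (1 - Dᵀ * D).PosDef)
    (A' : Matrix (Fin n) (Fin n) ℂ) (hA' : A' = A.map Complex.ofReal)
    (B' : Matrix (Fin n) (Fin p) ℂ) (hB' : B' = B.map Complex.ofReal)
    (C' : Matrix (Fin p) (Fin n) ℂ) (hC' : C' = C.map Complex.ofReal)
    (D' : Matrix (Fin p) (Fin p) ℂ) (hD' : D' = D.map Complex.ofReal)
    (hobs : ∀ x : Fin n → ℂ, (∀ k : ℕ, C'.mulVec ((A' ^ k).mulVec x) = 0) → x = 0)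
    (Ahat M N : Matrix (Fin n) (Fin n) ℂ)
    (hAhat : Ahat = A' + B' * D'ᵀ * (1 - D' * D'ᵀ)⁻¹ * C')
    (hM : M = C'ᵀ * (1 - D' * D'ᵀ)⁻¹ * C')
    (hN : N = B' * (1 - D'ᵀ * D')⁻¹ * B'ᵀ)
    (P : Matrix (Fin n) (Fin n) ℂ) (hP : Pᴴ = P)
    (hRicc : P * M * P + Ahat * P + P * Ahatᴴ + N = 0) :
    (∀ i j, (P i j).im = 0) ↔
      ∀ s : ℝ, ((s : ℂ) • (1 : Matrix (Fin n) (Fin n) ℂ) - A').det ≠ 0 →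
        ∀ i j, ((C' * ((s : ℂ) • (1 : Matrix (Fin n) (Fin n) ℂ) - A')⁻¹ * P * C'ᵀ) i j).im = 0 := by
  have hAr : A'ᴴ = A'ᵀ := hA' ▸ conjTranspose_map_ofReal A
  have hBr : B'ᴴ = B'ᵀ := hB' ▸ conjTranspose_map_ofReal B
  have hCr : C'ᴴ = C'ᵀ := hC' ▸ conjTranspose_map_ofReal C
  have hDr : D'ᴴ = D'ᵀ := hD' ▸ conjTranspose_map_ofReal D
  have hCr' : C'ᵀᴴ = C' := by rw [← hCr, conjTranspose_conjTranspose]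
  have hDr' : D'ᵀᴴ = D' := by rw [← hDr, conjTranspose_conjTranspose]
  have hRr : ∀ s : ℝ, ((s : ℂ) • (1 : Matrix (Fin n) (Fin n) ℂ) - A')⁻¹ᴴ =
      ((s : ℂ) • (1 : Matrix (Fin n) (Fin n) ℂ) - A')⁻¹ᵀ := by
    intro s
    simp [conjTranspose_nonsing_inv, transpose_nonsing_inv, hAr]
  rw [im_eq_zero_iff_conjTranspose_eq_transpose, hP]
  simp only [im_eq_zero_iff_conjTranspose_eq_transpose, conjTranspose_mul, transpose_mul,
    transpose_transpose, hRr, hCr, hCr', hP]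
  refine ⟨fun h s _ => by rw [← h], fun h => ?_⟩
  set X := P - Pᵀ with hX
  have hXt : Xᵀ = -X := by simp [hX]
  have hXC : X * C'ᵀ = 0 := by
    refine eq_zero_of_observable hobs (mul_pow_mul_eq_zero_of_resolvent A' C' _ fun s hs => ?_)
    have h' := congrArg transpose (h s hs)
    simp only [transpose_mul, transpose_transpose] at h'
    simp only [hX, Matrix.sub_mul, Matrix.mul_sub, ← Matrix.mul_assoc] at h' ⊢
    rw [h', sub_self]
  have hCX : C' * X = 0 := by
    simpa [hXt] using congrArg transpose hXC
  set G := B' * D'ᵀ * (1 - D' * D'ᵀ)⁻¹ with hG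
  have hGr : Gᴴ = Gᵀ := by
    simp [hG, conjTranspose_nonsing_inv, transpose_nonsing_inv, hBr, hDr, hDr']
  have hAhatr : Ahatᴴ = Ahatᵀ := by
    simp [hAhat, hGr, hAr, hCr]
  have hMt : Mᵀ = M := by
    simp [hM, transpose_nonsing_inv, Matrix.mul_assoc]
  have hNt : Nᵀ = N := by
    simp [hN, transpose_nonsing_inv, Matrix.mul_assoc]
  have hRicct : Pᵀ * M * Pᵀ + Ahat * Pᵀ + Pᵀ * Ahatᵀ + N = 0 := by
    have := congrArg transpose hRicc
    simp only [transpose_add, transpose_mul, hAhatr, transpose_transpose, hMt, hNt,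
      transpose_zero] at this
    rw [← this, Matrix.mul_assoc]
    abel
  have hXM : X * M = 0 := by
    rw [hM, ← Matrix.mul_assoc, ← Matrix.mul_assoc, hXC, Matrix.zero_mul, Matrix.zero_mul]
  have hMX : M * X = 0 := by
    rw [hM, Matrix.mul_assoc, hCX, Matrix.mul_zero]
  have hLyap : A' * X + X * A'ᵀ = 0 := by
    have hdiff : X * M * P + Pᵀ * (M * X) + Ahat * X + X * Ahatᵀ = 0 := by
      rw [hAhatr] at hRicc
      calc _ = (P * M * P + Ahat * P + P * Ahatᵀ + N) -
          (Pᵀ * M * Pᵀ + Ahat * Pᵀ + Pᵀ * Ahatᵀ + N) := by rw [hX]; noncomm_ring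
        _ = 0 := by rw [hRicc, hRicct, sub_zero]
    rw [hXM, hMX, Matrix.zero_mul, Matrix.mul_zero, zero_add, zero_add, hAhat] at hdiff
    simpa [Matrix.add_mul, Matrix.mul_add, Matrix.mul_assoc, hCX, ← Matrix.mul_assoc X,
      hXC] using hdiff
  have hCAX : ∀ k : ℕ, C' * A' ^ k * X = 0 := by
    intro k
    have hcomm : A' ^ k * X = X * (-A'ᵀ) ^ k := by
      have hsc : SemiconjBy X (-A'ᵀ) A' := by
        rw [SemiconjBy, mul_neg]
        exact (eq_neg_of_add_eq_zero_left hLyap).symm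
      exact (hsc.pow_right k).eq.symm
    rw [Matrix.mul_assoc, hcomm, ← Matrix.mul_assoc, hCX, Matrix.zero_mul]
  exact sub_eq_zero.mp (eq_zero_of_observable hobs hCAX)
end

section
/- Let d, q, p₁, r₁, r₂ be complex polynomials with d, r₁, r₂ nonzero. Assume: every complex root of d, of r₁, and of r₂ has strictly negative real part; r₂ is squarefree; and q·q⋆ − p₁·p₁⋆ = (r₁·r₁⋆)²·r₂·r₂⋆. If every complex root of the polynomial d·d⋆·(q·q⋆ − p₁·p₁⋆) has even multiplicity, then r₂ divides d. -/
open Polynomial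

/-- The para-conjugate of `f` evaluates at `z` to the conjugate of `f` at `-conj z`. -/
theorem eval_map_conj_comp_neg_X (f : Polynomial ℂ) (z : ℂ) :
    ((f.map (starRingEnd ℂ)).comp (-Polynomial.X)).eval z
      = starRingEnd ℂ (f.eval (-starRingEnd ℂ z)) := by
  have h : -z = starRingEnd ℂ (-starRingEnd ℂ z) := by simp
  rw [eval_comp, eval_neg, eval_X, h, eval_map_apply]

/-- The para-conjugate of a stable polynomial has no root in the open left half-plane. -/
theorem not_isRoot_map_conj_comp_neg_X {f : Polynomial ℂ}
    (hf : ∀ z : ℂ, f.IsRoot z → z.re < 0) {z : ℂ} (hz : z.re < 0) :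
    ¬ ((f.map (starRingEnd ℂ)).comp (-Polynomial.X)).IsRoot z := by
  intro h
  rw [IsRoot.def, eval_map_conj_comp_neg_X, map_eq_zero] at h
  have := hf _ h
  simp only [Complex.neg_re, Complex.conj_re] at this
  linarith

/-- If `d`, `r₁`, `r₂` are stable polynomials, `r₂` has simple roots,
`q q⋆ - p₁ p₁⋆ = (r₁ r₁⋆)² r₂ r₂⋆`, and every root of `d d⋆ (q q⋆ - p₁ p₁⋆)`
has even multiplicity, then `r₂` divides `d`. -/
theorem r2_divides_d
    (pc : Polynomial ℂ → Polynomial ℂ)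
    (hpc : ∀ f : Polynomial ℂ, pc f = (f.map (starRingEnd ℂ)).comp (-Polynomial.X))
    (d q p₁ r₁ r₂ : Polynomial ℂ)
    (hd : d ≠ 0) (hr₁ : r₁ ≠ 0) (hr₂ : r₂ ≠ 0)
    (hdstable : ∀ z : ℂ, d.IsRoot z → z.re < 0)
    (hr₁stable : ∀ z : ℂ, r₁.IsRoot z → z.re < 0)
    (hr₂stable : ∀ z : ℂ, r₂.IsRoot z → z.re < 0)
    (hr₂simple : ∀ z : ℂ, r₂.IsRoot z → r₂.rootMultiplicity z = 1)
    (hfact : q * pc q - p₁ * pc p₁ = (r₁ * pc r₁) ^ 2 * (r₂ * pc r₂))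
    (heven : ∀ z : ℂ, (d * pc d * (q * pc q - p₁ * pc p₁)).IsRoot z →
      Even ((d * pc d * (q * pc q - p₁ * pc p₁)).rootMultiplicity z)) :
    r₂ ∣ d := by
  have hmult : ∀ f : Polynomial ℂ, f ≠ 0 → (∀ z : ℂ, f.IsRoot z → z.re < 0) →
      ∀ z : ℂ, z.re < 0 →
        f * pc f ≠ 0 ∧ (f * pc f).rootMultiplicity z = f.rootMultiplicity z := by
    intro f hf hstable z hz
    have hroot : ¬ (pc f).IsRoot z := hpc f ▸ not_isRoot_map_conj_comp_neg_X hstable hz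
    have hne : f * pc f ≠ 0 := mul_ne_zero hf fun h => hroot (by simp [h])
    exact ⟨hne, by rw [rootMultiplicity_mul hne, rootMultiplicity_eq_zero hroot, add_zero]⟩
  have hroot : ∀ z : ℂ, r₂.IsRoot z → d.IsRoot z := by
    intro z hz
    have hre := hr₂stable z hz
    obtain ⟨hd0, hdm⟩ := hmult d hd hdstable z hre
    obtain ⟨h10, h1m⟩ := hmult r₁ hr₁ hr₁stable z hre
    obtain ⟨h20, h2m⟩ := hmult r₂ hr₂ hr₂stable z hre
    have hsq := pow_ne_zero 2 h10
    have hev := heven z (by rw [hfact]; simp [hz.eq_zero])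
    rw [hfact, rootMultiplicity_mul (mul_ne_zero hd0 (mul_ne_zero hsq h20)),
      rootMultiplicity_mul (mul_ne_zero hsq h20), pow_two,
      rootMultiplicity_mul (mul_ne_zero h10 h10), hdm, h1m, h2m, hr₂simple z hz] at hev
    by_contra hdz
    rw [rootMultiplicity_eq_zero hdz] at hev
    grind
  refine (IsAlgClosed.splits r₂).dvd_of_roots_le_roots hr₂ (Multiset.le_iff_count.2 fun z => ?_)
  rw [count_roots, count_roots]
  by_cases hz : r₂.IsRoot z
  · rw [hr₂simple z hz]
    exact (rootMultiplicity_pos hd).2 (hroot z hz)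
  · simp [rootMultiplicity_eq_zero hz]
end

section
/- Let J = diag(I_r, −I_{n−r}) be an n×n signature matrix, and let A, B, C, D be real matrices of sizes n×n, n×p, p×n, p×p with I_p − D·Dᵀ positive definite, satisfying the signature-symmetry relations Aᵀ = J·A·J, Bᵀ = C·J, Cᵀ = J·B, Dᵀ = D. Then Âᵀ = J·Â·J, Nᵀ = J·M·J, Mᵀ = J·N·J, and for every invertible Hermitian n×n complex matrix P with R(P) = 0, the matrix P̃ := J·(P⁻¹)ᵀ·J is Hermitian and satisfies R(P̃) = 0. -/
open Matrix

/-- A matrix over a commutative ring commutes with the inverse of any matrix it commutes with. -/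
lemma Matrix.mul_inv_eq_inv_mul_of_commute {m R : Type*} [Fintype m] [DecidableEq m] [CommRing R]
    {X Y : Matrix m m R} (h : X * Y = Y * X) : X * Y⁻¹ = Y⁻¹ * X := by
  by_cases hY : IsUnit Y.det
  · calc X * Y⁻¹ = Y⁻¹ * (Y * X) * Y⁻¹ := by rw [Matrix.nonsing_inv_mul_cancel_left _ _ hY]
      _ = Y⁻¹ * X := by
        rw [← h, ← Matrix.mul_assoc, Matrix.mul_nonsing_inv_cancel_right _ _ hY]
  · simp [Matrix.nonsing_inv_apply_not_isUnit _ hY]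

/-- Signature duality for Riccati solutions: if `Âᵀ = J Â J`, `Nᵀ = J M J` and `Mᵀ = J N J`
with `J` a symmetric involution, then `P ↦ J (P⁻¹)ᵀ J` preserves the invertible Hermitian
solutions of the Riccati equation. -/
lemma riccati_signature_dual {m : Type*} [Fintype m] [DecidableEq m]
    {J F M N P : Matrix m m ℂ} (hJJ : J * J = 1) (hJH : Jᴴ = J)
    (hF : Fᵀ = J * F * J) (hN : Nᵀ = J * M * J) (hM : Mᵀ = J * N * J)
    (hP : IsUnit P) (hPH : Pᴴ = P) (hR : P * M * P + F * P + P * Fᴴ + N = 0) :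
    (J * (P⁻¹)ᵀ * J)ᴴ = J * (P⁻¹)ᵀ * J ∧
      (J * (P⁻¹)ᵀ * J) * M * (J * (P⁻¹)ᵀ * J) +
        F * (J * (P⁻¹)ᵀ * J) + (J * (P⁻¹)ᵀ * J) * Fᴴ + N = 0 := by
  have hdet : IsUnit P.det := (Matrix.isUnit_iff_isUnit_det P).mp hP
  have hJl (X : Matrix m m ℂ) : J * (J * X) = X := by
    rw [← Matrix.mul_assoc, hJJ, Matrix.one_mul]
  have hFH : (Fᴴ)ᵀ = J * Fᴴ * J := by
    have h : (Fᵀ)ᴴ = J * Fᴴ * J := by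
      rw [hF, conjTranspose_mul, conjTranspose_mul, hJH, Matrix.mul_assoc]
    rw [← h]
    rfl
  have hQH : ((P⁻¹)ᵀ)ᴴ = (P⁻¹)ᵀ := by
    change ((P⁻¹)ᴴ)ᵀ = (P⁻¹)ᵀ
    rw [conjTranspose_nonsing_inv, hPH]
  have hQ : P⁻¹ * N * P⁻¹ + P⁻¹ * F + Fᴴ * P⁻¹ + M = 0 := by
    calc P⁻¹ * N * P⁻¹ + P⁻¹ * F + Fᴴ * P⁻¹ + M
        = P⁻¹ * (P * M * P + F * P + P * Fᴴ + N) * P⁻¹ := by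
          simp only [Matrix.mul_add, Matrix.add_mul, Matrix.mul_assoc,
            Matrix.mul_nonsing_inv _ hdet, Matrix.mul_one,
            Matrix.nonsing_inv_mul_cancel_left _ _ hdet]
          abel
      _ = 0 := by rw [hR, Matrix.mul_zero, Matrix.zero_mul]
  refine ⟨?_, ?_⟩
  · rw [conjTranspose_mul, conjTranspose_mul, hJH, hQH, Matrix.mul_assoc]
  · calc (J * (P⁻¹)ᵀ * J) * M * (J * (P⁻¹)ᵀ * J) +
          F * (J * (P⁻¹)ᵀ * J) + (J * (P⁻¹)ᵀ * J) * Fᴴ + N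
        = J * (P⁻¹ * N * P⁻¹ + P⁻¹ * F + Fᴴ * P⁻¹ + M)ᵀ * J := by
          simp only [transpose_add, transpose_mul, hF, hN, hM, hFH, Matrix.mul_add,
            Matrix.add_mul, Matrix.mul_assoc, hJl, hJJ, Matrix.mul_one]
      _ = 0 := by rw [hQ, transpose_zero, Matrix.mul_zero, Matrix.zero_mul]

/-- For a signature-symmetric real realization (`Aᵀ = J A J`, `Bᵀ = C J`,
`Cᵀ = J B`, `Dᵀ = D`), one has `Âᵀ = J Â J`, `Nᵀ = J M J`, `Mᵀ = J N J`, and if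
`P` is an invertible Hermitian solution of the Riccati equation then so is
`J (P⁻¹)ᵀ J`. -/
theorem signature_symmetric_riccati {n p : ℕ} (hn : 0 < n) (hp : 0 < p)
    (r : ℕ) (hr : r ≤ n)
    (A : Matrix (Fin n) (Fin n) ℝ) (B : Matrix (Fin n) (Fin p) ℝ)
    (C : Matrix (Fin p) (Fin n) ℝ) (D : Matrix (Fin p) (Fin p) ℝ)
    (hD1 : (1 - D * Dᵀ).PosDef)
    (J : Matrix (Fin n) (Fin n) ℝ)
    (hJ : J = Matrix.diagonal (fun i : Fin n => if (i : ℕ) < r then (1 : ℝ) else -1))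
    (hA : Aᵀ = J * A * J) (hB : Bᵀ = C * J) (hC : Cᵀ = J * B) (hD : Dᵀ = D)
    (A' : Matrix (Fin n) (Fin n) ℂ) (hA' : A' = A.map Complex.ofReal)
    (B' : Matrix (Fin n) (Fin p) ℂ) (hB' : B' = B.map Complex.ofReal)
    (C' : Matrix (Fin p) (Fin n) ℂ) (hC' : C' = C.map Complex.ofReal)
    (D' : Matrix (Fin p) (Fin p) ℂ) (hD'c : D' = D.map Complex.ofReal)
    (J' : Matrix (Fin n) (Fin n) ℂ) (hJ' : J' = J.map Complex.ofReal)
    (Ahat M N : Matrix (Fin n) (Fin n) ℂ)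
    (hAhat : Ahat = A' + B' * D'ᵀ * (1 - D' * D'ᵀ)⁻¹ * C')
    (hM : M = C'ᵀ * (1 - D' * D'ᵀ)⁻¹ * C')
    (hN : N = B' * (1 - D'ᵀ * D')⁻¹ * B'ᵀ) :
    Ahatᵀ = J' * Ahat * J' ∧ Nᵀ = J' * M * J' ∧ Mᵀ = J' * N * J' ∧
    ∀ P : Matrix (Fin n) (Fin n) ℂ, IsUnit P → Pᴴ = P →
      P * M * P + Ahat * P + P * Ahatᴴ + N = 0 →
      ((J' * (P⁻¹)ᵀ * J')ᴴ = J' * (P⁻¹)ᵀ * J' ∧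
        (J' * (P⁻¹)ᵀ * J') * M * (J' * (P⁻¹)ᵀ * J') +
          Ahat * (J' * (P⁻¹)ᵀ * J') + (J' * (P⁻¹)ᵀ * J') * Ahatᴴ + N = 0) := by
  have hJJ : J' * J' = 1 := by
    rw [hJ', hJ, diagonal_map Complex.ofReal_zero, diagonal_mul_diagonal, ← diagonal_one]
    congr 1
    funext i
    by_cases h : (i : ℕ) < r <;> simp [h]
  have hJH : J'ᴴ = J' := by
    rw [hJ', hJ, diagonal_map Complex.ofReal_zero, diagonal_conjTranspose]
    congr 1
    funext i
    simp
  have hJT : J'ᵀ = J' := by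
    rw [hJ', hJ, diagonal_map Complex.ofReal_zero, diagonal_transpose]
  have hAc : A'ᵀ = J' * A' * J' := by
    rw [hA', hJ', ← transpose_map, hA]
    change (J * A * J).map Complex.ofRealHom = _
    rw [Matrix.map_mul, Matrix.map_mul]
    rfl
  have hBc : B'ᵀ = C' * J' := by
    rw [hB', hC', hJ', ← transpose_map, hB]
    exact Matrix.map_mul (f := Complex.ofRealHom)
  have hCc : C'ᵀ = J' * B' := by
    rw [hB', hC', hJ', ← transpose_map, hC]
    exact Matrix.map_mul (f := Complex.ofRealHom)
  have hDc : D'ᵀ = D' := by rw [hD'c, ← transpose_map, hD]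
  rw [hDc] at hAhat hM hN
  have hST : ((1 - D' * D')⁻¹)ᵀ = (1 - D' * D')⁻¹ := by
    rw [transpose_nonsing_inv, transpose_sub, transpose_mul, transpose_one, hDc]
  have hSD : D' * (1 - D' * D')⁻¹ = (1 - D' * D')⁻¹ * D' :=
    Matrix.mul_inv_eq_inv_mul_of_commute (by noncomm_ring)
  have hF : Ahatᵀ = J' * Ahat * J' := by
    have hSD' (X : Matrix (Fin p) (Fin n) ℂ) :
        D' * ((1 - D' * D')⁻¹ * X) = (1 - D' * D')⁻¹ * (D' * X) := by
      rw [← Matrix.mul_assoc, hSD, Matrix.mul_assoc]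
    simp only [hAhat, transpose_add, transpose_mul, hAc, hBc, hCc, hDc, hST, Matrix.mul_add,
      Matrix.add_mul, Matrix.mul_assoc, hSD']
  have hNT : Nᵀ = J' * M * J' := by
    simp only [hN, hM, transpose_mul, hJT, hST, hBc, hCc, Matrix.mul_assoc]
  have hMT : Mᵀ = J' * N * J' := by
    simp only [hN, hM, transpose_mul, hJT, hST, hBc, hCc, Matrix.mul_assoc,
      hJJ, Matrix.mul_one]
  exact ⟨hF, hNT, hMT, fun P hP hPH hR => riccati_signature_dual hJJ hJH hF hNT hMT hP hPH hR⟩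
end

section
/- Let P and P̃ be n×n Hermitian complex matrices with R(P) = 0 and R(P̃) = 0. Define D₂₁ := (I_p − D·D*)^{1/2} (the positive definite Hermitian square root), B₁ := −(P·C* + B·D*)·D₂₁⁻¹, B̃₁ := −(P̃·C* + B·D*)·D₂₁⁻¹, and Z := Â + P·M. Then: (a) A − B₁·D₂₁⁻¹·C = Z; and (b) for every complex s such that sI_n − A, sI_n − Z, and S₂₁(s) := D₂₁ + C·(sI_n − A)⁻¹·B₁ are invertible, with S̃₂₁(s) := D₂₁ + C·(sI_n − A)⁻¹·B̃₁, one has S₂₁(s)⁻¹·S̃₂₁(s) = I_p − D₂₁⁻¹·C·(sI_n − Z)⁻¹·(P̃ − P)·C*·D₂₁⁻¹. -/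
open Matrix ComplexOrder

/-- A realization `D + C Φ⁻¹ K` composed with the output map `D⁻¹ C` of its inverse, whose
resolvent is `(Φ + K D⁻¹ C)⁻¹`, collapses to `C Φ⁻¹`. -/
theorem Matrix.realization_mul_output_resolvent {m k R : Type*} [Fintype m] [DecidableEq m]
    [Fintype k] [DecidableEq k] [CommRing R] {Φ : Matrix m m R} {D : Matrix k k R}
    (C : Matrix k m R) (K : Matrix m k R) (hΦ : IsUnit Φ) (hD : IsUnit D)
    (hΨ : IsUnit (Φ + K * D⁻¹ * C)) :
    (D + C * Φ⁻¹ * K) * (D⁻¹ * C * (Φ + K * D⁻¹ * C)⁻¹) = C * Φ⁻¹ := by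
  rw [Matrix.isUnit_iff_isUnit_det] at hΦ hD hΨ
  have hfactor : (D + C * Φ⁻¹ * K) * (D⁻¹ * C) = C * Φ⁻¹ * (Φ + K * D⁻¹ * C) := by
    rw [Matrix.add_mul, Matrix.mul_add, Matrix.mul_nonsing_inv_cancel_left _ _ hD,
      Matrix.nonsing_inv_mul_cancel_right _ _ hΦ]
    simp only [Matrix.mul_assoc]
  rw [← Matrix.mul_assoc, hfactor, Matrix.mul_nonsing_inv_cancel_right _ _ hΨ]

/-- For two Hermitian solutions `P`, `P̃` of the Riccati equation, with
`D₂₁ = (I - D Dᴴ)^{1/2}`, `B₁ = -(P Cᴴ + B Dᴴ) D₂₁⁻¹`,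
`B̃₁ = -(P̃ Cᴴ + B Dᴴ) D₂₁⁻¹` and `Z = Â + P M`: (a) `A - B₁ D₂₁⁻¹ C = Z`, and
(b) `S₂₁(s)⁻¹ S̃₂₁(s) = I - D₂₁⁻¹ C (sI - Z)⁻¹ (P̃ - P) Cᴴ D₂₁⁻¹` whenever the
relevant matrices are invertible. -/
theorem quotient_of_spectral_factors {n p : ℕ} (hn : 0 < n) (hp : 0 < p)
    (A : Matrix (Fin n) (Fin n) ℂ) (B : Matrix (Fin n) (Fin p) ℂ)
    (C : Matrix (Fin p) (Fin n) ℂ) (D : Matrix (Fin p) (Fin p) ℂ)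
    (hD1 : (1 - D * Dᴴ).PosDef) (hD2 : (1 - Dᴴ * D).PosDef)
    (Ahat M N : Matrix (Fin n) (Fin n) ℂ)
    (hAhat : Ahat = A + B * Dᴴ * (1 - D * Dᴴ)⁻¹ * C)
    (hM : M = Cᴴ * (1 - D * Dᴴ)⁻¹ * C)
    (hN : N = B * (1 - Dᴴ * D)⁻¹ * Bᴴ)
    (P Pt : Matrix (Fin n) (Fin n) ℂ) (hP : Pᴴ = P) (hPt : Ptᴴ = Pt)
    (hRicc : P * M * P + Ahat * P + P * Ahatᴴ + N = 0)
    (hRicct : Pt * M * Pt + Ahat * Pt + Pt * Ahatᴴ + N = 0)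
    -- `D21` is the unique positive definite Hermitian square root of `I - D Dᴴ`
    (D21 : Matrix (Fin p) (Fin p) ℂ) (hD21 : D21.PosDef)
    (hD21sq : D21 * D21 = 1 - D * Dᴴ)
    (B₁ Bt₁ : Matrix (Fin n) (Fin p) ℂ)
    (hB₁ : B₁ = -((P * Cᴴ + B * Dᴴ) * D21⁻¹))
    (hBt₁ : Bt₁ = -((Pt * Cᴴ + B * Dᴴ) * D21⁻¹))
    (Z : Matrix (Fin n) (Fin n) ℂ) (hZ : Z = Ahat + P * M)
    (S21 St21 : ℂ → Matrix (Fin p) (Fin p) ℂ)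
    (hS21 : ∀ s : ℂ, S21 s = D21 + C * (s • (1 : Matrix (Fin n) (Fin n) ℂ) - A)⁻¹ * B₁)
    (hSt21 : ∀ s : ℂ, St21 s = D21 + C * (s • (1 : Matrix (Fin n) (Fin n) ℂ) - A)⁻¹ * Bt₁) :
    A - B₁ * D21⁻¹ * C = Z ∧
    ∀ s : ℂ,
      IsUnit (s • (1 : Matrix (Fin n) (Fin n) ℂ) - A) →
      IsUnit (s • (1 : Matrix (Fin n) (Fin n) ℂ) - Z) →
      IsUnit (S21 s) →
      (S21 s)⁻¹ * St21 s =
        1 - D21⁻¹ * C * (s • (1 : Matrix (Fin n) (Fin n) ℂ) - Z)⁻¹ * (Pt - P) * Cᴴ * D21⁻¹ := by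
  have hinv : D21⁻¹ * D21⁻¹ = (1 - D * Dᴴ)⁻¹ := by rw [← Matrix.mul_inv_rev, hD21sq]
  have hstate : A - B₁ * D21⁻¹ * C = Z := by
    rw [hB₁, hZ, hAhat, hM, ← hinv]
    simp only [Matrix.neg_mul, Matrix.add_mul, Matrix.mul_assoc]
    abel
  refine ⟨hstate, fun s hA hZs hS ↦ ?_⟩
  have hresolvent : s • (1 : Matrix (Fin n) (Fin n) ℂ) - Z =
      s • (1 : Matrix (Fin n) (Fin n) ℂ) - A + B₁ * D21⁻¹ * C := by
    rw [← hstate]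
    abel
  have hcollapse : S21 s * (D21⁻¹ * C * (s • (1 : Matrix (Fin n) (Fin n) ℂ) - Z)⁻¹) =
      C * (s • (1 : Matrix (Fin n) (Fin n) ℂ) - A)⁻¹ := by
    rw [hresolvent] at hZs ⊢
    rw [hS21]
    exact Matrix.realization_mul_output_resolvent C B₁ hA hD21.isUnit hZs
  have hinput : Bt₁ = B₁ - (Pt - P) * Cᴴ * D21⁻¹ := by
    rw [hBt₁, hB₁]
    simp only [Matrix.add_mul, Matrix.sub_mul]
    abel
  have hfactor : St21 s = S21 s * (1 - D21⁻¹ * C *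
      (s • (1 : Matrix (Fin n) (Fin n) ℂ) - Z)⁻¹ * (Pt - P) * Cᴴ * D21⁻¹) := by
    have hassoc : D21⁻¹ * C * (s • (1 : Matrix (Fin n) (Fin n) ℂ) - Z)⁻¹ * (Pt - P) * Cᴴ * D21⁻¹ =
        D21⁻¹ * C * (s • (1 : Matrix (Fin n) (Fin n) ℂ) - Z)⁻¹ * ((Pt - P) * Cᴴ * D21⁻¹) := by
      simp only [Matrix.mul_assoc]
    rw [hassoc, Matrix.mul_sub, Matrix.mul_one, ← Matrix.mul_assoc (S21 s), hcollapse, hSt21,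
      hS21, hinput, Matrix.mul_sub, add_sub_assoc]
  rw [hfactor, Matrix.nonsing_inv_mul_cancel_left _ _ ((Matrix.isUnit_iff_isUnit_det _).mp hS)]
end
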